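/- arXiv:math/0610571 — 11 statements merged into one kernel-verified Lean document; each statement's English description precedes it below -/
import Mathlib

section
/- Let X be a finite nonempty set, m : X → (0,∞), and let L be a real X×X matrix such that for some ε > 0 one has Re⟨−Lz, z̄⟩_m ≥ ε⟨z, z̄⟩_m for all z ∈ ℂ^X. Then for every χ : X → [0,∞) and all x, y ∈ X, (2π)^{−|X|} ∫_{ℂ^X} z_x \overline{z_y} exp(−(1/2)⟨zz̄, χ⟩_m + (1/2)⟨Lz, z̄⟩_m) ∏_{u∈X} dx_u dy_u = 2 · det(−M_m L + M_{χm})^{−1} · ((−L + M_χ)^{−1})_{x y} / m_y. -/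
open MeasureTheory Matrix ComplexConjugate

lemma aux_int_real (b : ℝ) (hb : 0 < b) :
    Integrable (fun z : ℂ => (1 + ‖z‖ ^ 2) * Real.exp (-b * ‖z‖ ^ 2)) := by
  have h1 := GaussianFourier.integrable_cexp_neg_mul_sq_norm_add (V := ℂ) (b := ((b / 2 : ℝ) : ℂ))
    (by simpa using hb) 0 0
  have h2 := (h1.norm).const_mul (1 + 2 / b)
  refine h2.mono' (by fun_prop) (Filter.Eventually.of_forall fun z => ?_)
  rw [Real.norm_of_nonneg (by positivity), Complex.norm_exp]
  have e1 : (-((b / 2 : ℝ) : ℂ) * (‖z‖ : ℂ) ^ 2 + 0 * ((inner ℝ (0:ℂ) z : ℝ) : ℂ)).re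
      = -(b / 2) * ‖z‖ ^ 2 := by
    rw [zero_mul, add_zero]; norm_cast
  rw [e1]
  have e2 : Real.exp (-b * ‖z‖ ^ 2) = Real.exp (-(b / 2) * ‖z‖ ^ 2) * Real.exp (-(b / 2) * ‖z‖ ^ 2) := by
    rw [← Real.exp_add]; congr 1; ring
  rw [e2, ← mul_assoc]
  refine mul_le_mul_of_nonneg_right ?_ (Real.exp_pos _).le
  have e3 := Real.add_one_le_exp (b / 2 * ‖z‖ ^ 2)
  have e4 : Real.exp (-(b / 2) * ‖z‖ ^ 2) ≤ 1 := Real.exp_le_one_iff.2 (by nlinarith [sq_nonneg ‖z‖])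
  have e5 : ‖z‖ ^ 2 * Real.exp (-(b / 2) * ‖z‖ ^ 2) ≤ 2 / b := by
    rw [neg_mul, Real.exp_neg, ← div_eq_mul_inv, div_le_div_iff₀ (Real.exp_pos _) hb]
    nlinarith
  linarith

lemma aux_norm_g (b z : ℂ) : ‖Complex.exp (-b * (‖z‖ : ℂ) ^ 2)‖ = Real.exp (-b.re * ‖z‖ ^ 2) := by
  rw [Complex.norm_exp]; congr 1
  have : (-b * (‖z‖ : ℂ) ^ 2) = ((‖z‖ ^ 2 : ℝ) : ℂ) * (-b) := by push_cast; ring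
  rw [this, Complex.re_ofReal_mul]; simp; ring

lemma aux_int (b : ℂ) (hb : 0 < b.re) (p : ℂ → ℂ) (hp : Continuous p)
    (hp' : ∀ z, ‖p z‖ ≤ 1 + ‖z‖ ^ 2) :
    Integrable (fun z : ℂ => p z * Complex.exp (-b * (‖z‖ : ℂ) ^ 2)) := by
  refine (aux_int_real b.re hb).mono' (by fun_prop) (Filter.Eventually.of_forall fun z => ?_)
  rw [norm_mul, aux_norm_g]
  exact mul_le_mul_of_nonneg_right (hp' z) (Real.exp_pos _).le

lemma aux_m0 (b : ℂ) (hb : 0 < b.re) :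
    ∫ z : ℂ, Complex.exp (-b * (‖z‖ : ℂ) ^ 2) = Real.pi / b := by
  rw [GaussianFourier.integral_cexp_neg_mul_sq_norm hb]; simp

lemma aux_m1 (b : ℂ) : ∫ z : ℂ, z * Complex.exp (-b * (‖z‖ : ℂ) ^ 2) = 0 := by
  have h := integral_neg_eq_self (fun z : ℂ => z * Complex.exp (-b * (‖z‖ : ℂ) ^ 2)) volume
  simp only [norm_neg, neg_mul, integral_neg] at h ⊢
  exact self_eq_neg.1 h.symm

lemma aux_m1c (b : ℂ) : ∫ z : ℂ, conj z * Complex.exp (-b * (‖z‖ : ℂ) ^ 2) = 0 := by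
  have h := integral_neg_eq_self (fun z : ℂ => conj z * Complex.exp (-b * (‖z‖ : ℂ) ^ 2)) volume
  simp only [norm_neg, map_neg, neg_mul, integral_neg] at h ⊢
  exact self_eq_neg.1 h.symm

lemma aux_m2 (b : ℂ) (hb : 0 < b.re) :
    ∫ z : ℂ, z * conj z * Complex.exp (-b * (‖z‖ : ℂ) ^ 2) = Real.pi / b ^ 2 := by
  have hb0 : b ≠ 0 := by rintro rfl; simp at hb
  have key := hasDerivAt_integral_of_dominated_loc_of_deriv_le (μ := (volume : Measure ℂ))
    (F := fun (c : ℂ) (z : ℂ) => Complex.exp (-c * (‖z‖ : ℂ) ^ 2))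
    (F' := fun (c : ℂ) (z : ℂ) => (-(z * conj z)) * Complex.exp (-c * (‖z‖ : ℂ) ^ 2))
    (x₀ := b) (s := Metric.ball b (b.re / 2))
    (bound := fun z => (1 + ‖z‖ ^ 2) * Real.exp (-(b.re / 2) * ‖z‖ ^ 2))
    (Metric.ball_mem_nhds _ (by positivity))
    (Filter.Eventually.of_forall fun c => by fun_prop)
    (by simpa using aux_int b hb (fun _ => 1) (by fun_prop) (fun z => by simp))
    (by fun_prop)
    (Filter.Eventually.of_forall fun z c hc => by
      rw [norm_mul, aux_norm_g]
      have h1 : ‖-(z * conj z)‖ ≤ 1 + ‖z‖ ^ 2 := by simp; nlinarith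
      have h2 : b.re / 2 ≤ c.re := by
        have := (Complex.abs_re_le_norm (c - b)).trans_lt (mem_ball_iff_norm.1 hc)
        rw [Complex.sub_re] at this
        linarith [(abs_lt.1 this).1]
      refine mul_le_mul h1 (Real.exp_le_exp.2 ?_) (Real.exp_pos _).le (by positivity)
      nlinarith [sq_nonneg ‖z‖])
    (aux_int_real _ (by positivity))
    (Filter.Eventually.of_forall fun z c hc => by
      have h : HasDerivAt (fun c : ℂ => -c * (‖z‖ : ℂ) ^ 2) (-1 * (‖z‖ : ℂ) ^ 2) c :=
        ((hasDerivAt_id c).neg).mul_const _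
      have := h.cexp
      convert! this using 1
      rw [Complex.mul_conj, Complex.normSq_eq_norm_sq]; push_cast; ring)
  have h2 : HasDerivAt (fun c : ℂ => (Real.pi : ℂ) / c) (-(Real.pi / b ^ 2)) b := by
    have := (hasDerivAt_inv hb0).const_mul (Real.pi : ℂ)
    convert! this using 1
    field_simp
  have h3 := key.2.unique (h2.congr_of_eventuallyEq (by
    have : {c : ℂ | 0 < c.re} ∈ nhds b :=
      (isOpen_lt continuous_const Complex.continuous_re).mem_nhds hb
    filter_upwards [this] with c hc using aux_m0 c hc))
  simp only [neg_mul, integral_neg] at h3 ⊢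
  exact neg_injective h3

lemma aux_decomp {X : Type} [Fintype X] [DecidableEq X] (A : Matrix X X ℂ)
    (hA : ∀ z : X → ℂ, z ≠ 0 → 0 < (star z ⬝ᵥ (A *ᵥ z)).re) :
    ∃ (C : Matrix X X ℂ) (d : X → ℂ), IsUnit C ∧ (∀ i, 0 < (d i).re) ∧
      A = Cᴴ * diagonal d * C := by
  set H : Matrix X X ℂ := (1 / 2 : ℂ) • (A + Aᴴ) with hH
  set K : Matrix X X ℂ := (-Complex.I / 2) • (A - Aᴴ) with hK
  have hAHK : A = H + Complex.I • K := by
    ext i j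
    simp [hH, hK]
    linear_combination ((A i j - conj (A j i)) / 2) * Complex.I_sq
  have hKh : K.IsHermitian := by
    rw [IsHermitian, hK, conjTranspose_smul, conjTranspose_sub, conjTranspose_conjTranspose]
    ext i j; simp; ring
  have hHh : H.IsHermitian := by
    rw [IsHermitian, hH, conjTranspose_smul, conjTranspose_add, conjTranspose_conjTranspose]
    ext i j; simp; ring
  open scoped ComplexOrder in
  have hHp : H.PosDef := by
    refine .of_dotProduct_mulVec_pos hHh fun z hz => ?_
    have h1 : star z ⬝ᵥ (Aᴴ *ᵥ z) = conj (star z ⬝ᵥ (A *ᵥ z)) := by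
      rw [← Complex.star_def, star_dotProduct, star_mulVec, dotProduct_mulVec,
        conjTranspose_conjTranspose]
    have h2 : star z ⬝ᵥ (H *ᵥ z) = (((star z ⬝ᵥ (A *ᵥ z)).re : ℝ) : ℂ) := by
      rw [hH, smul_mulVec, add_mulVec, dotProduct_smul, dotProduct_add, h1, Complex.add_conj]
      simp
    rw [h2]; exact_mod_cast hA z hz
  obtain ⟨B, hB, hBB⟩ : ∃ B : Matrix X X ℂ, IsUnit B ∧ H = Bᴴ * B := by
    open scoped ComplexOrder MatrixOrder Matrix.Norms.L2Operator in
    obtain ⟨B, hB, h⟩ := CStarAlgebra.isStrictlyPositive_iff_eq_star_mul_self.mp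
        hHp.isStrictlyPositive
    exact ⟨B, hB, h⟩
  have hBdet : IsUnit B.det := (isUnit_iff_isUnit_det B).1 hB
  set K' : Matrix X X ℂ := (B⁻¹)ᴴ * K * B⁻¹ with hK'
  have hK'h : K'.IsHermitian := isHermitian_conjTranspose_mul_mul _ hKh
  have hKK : K = Bᴴ * K' * B := by
    have e1 : Bᴴ * (B⁻¹)ᴴ = 1 := by
      rw [← conjTranspose_mul, nonsing_inv_mul _ hBdet, conjTranspose_one]
    calc K = (Bᴴ * (B⁻¹)ᴴ) * K * (B⁻¹ * B) := by rw [e1, nonsing_inv_mul _ hBdet]; simp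
      _ = _ := by rw [hK']; simp only [Matrix.mul_assoc]
  have hsp := hK'h.spectral_theorem
  rw [Unitary.conjStarAlgAut_apply] at hsp
  set U : Matrix X X ℂ := (hK'h.eigenvectorUnitary : Matrix X X ℂ) with hU
  have hUU : U * Uᴴ = 1 := Unitary.coe_mul_star_self hK'h.eigenvectorUnitary
  have hUU' : Uᴴ * U = 1 := Unitary.coe_star_mul_self hK'h.eigenvectorUnitary
  refine ⟨Uᴴ * B, fun i => 1 + Complex.I * (hK'h.eigenvalues i : ℂ), ?_, ?_, ?_⟩
  · exact (IsUnit.of_mul_eq_one _ hUU').mul hB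
  · intro i; simp
  · have hd : diagonal (fun i => 1 + Complex.I * (hK'h.eigenvalues i : ℂ)) =
        1 + Complex.I • diagonal (RCLike.ofReal ∘ hK'h.eigenvalues : X → ℂ) := by
      ext i j
      by_cases h : i = j
      · subst h; simp
      · simp [h]
    rw [hd, conjTranspose_mul, conjTranspose_conjTranspose]
    have e : Bᴴ * U * (1 + Complex.I • diagonal (RCLike.ofReal ∘ hK'h.eigenvalues : X → ℂ)) * (Uᴴ * B)
       = Bᴴ * (U * Uᴴ) * B + Complex.I • (Bᴴ * (U * diagonal (RCLike.ofReal ∘ hK'h.eigenvalues : X → ℂ) * Uᴴ) * B) := by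
      simp only [Matrix.mul_add, Matrix.add_mul, Matrix.mul_assoc, Matrix.mul_smul, Matrix.smul_mul, Matrix.mul_one]
    rw [e, hUU, Matrix.mul_one, ← hBB]
    conv_lhs => rw [hAHK, hKK, hsp]
    rfl

lemma aux_cov {X : Type} [Fintype X] [DecidableEq X] (C : Matrix X X ℂ) (hC : IsUnit C)
    (f : (X → ℂ) → ℂ) :
    ∫ z : X → ℂ, f (C *ᵥ z) = ((Complex.normSq C.det)⁻¹ : ℝ) * ∫ z : X → ℂ, f z := by
  have hdet : C.det ≠ 0 := ((isUnit_iff_isUnit_det C).1 hC).ne_zero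
  set g : (X → ℂ) →ₗ[ℝ] (X → ℂ) := (Matrix.toLin' C).restrictScalars ℝ with hg
  have hgd : LinearMap.det g = Complex.normSq C.det := by
    rw [hg, LinearMap.det_restrictScalars, Algebra.norm_complex_eq, LinearMap.det_toLin']; rfl
  have hpos : 0 < Complex.normSq C.det := Complex.normSq_pos.2 hdet
  have hgd0 : LinearMap.det g ≠ 0 := by rw [hgd]; exact hpos.ne'
  have hmap := Measure.map_linearMap_addHaar_eq_smul_addHaar (volume : Measure (X → ℂ)) hgd0
  have hemb : MeasurableEmbedding g := by
    have := (LinearMap.equivOfDetNeZero g hgd0).toContinuousLinearEquiv.toHomeomorph.measurableEmbedding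
    exact this
  have h1 := hemb.integral_map (μ := volume) f
  rw [hmap, integral_smul_measure, hgd] at h1
  have h2 : ∀ z, g z = C *ᵥ z := fun z => by simp [hg]
  simp only [h2] at h1
  rw [← h1, ENNReal.toReal_ofReal (abs_nonneg _), abs_of_pos (by positivity)]
  rfl

lemma aux_diag {X : Type} [Fintype X] [DecidableEq X] (d : X → ℂ) (hd : ∀ i, 0 < (d i).re)
    (u v : X) :
    Integrable (fun w : X → ℂ => w u * conj (w v) *
        Complex.exp (-(1/2) * ∑ k, d k * (‖w k‖ : ℂ) ^ 2)) ∧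
    ∫ w : X → ℂ, w u * conj (w v) *
        Complex.exp (-(1/2) * ∑ k, d k * (‖w k‖ : ℂ) ^ 2) =
      if u = v then (2 * Real.pi) ^ (Fintype.card X) * (∏ k, d k)⁻¹ * (2 / d u) else 0 := by
  set p : X → ℂ → ℂ := fun k z => (if k = u then z else 1) * (if k = v then conj z else 1) with hp
  set f : X → ℂ → ℂ := fun k z => p k z * Complex.exp (-(d k / 2) * (‖z‖ : ℂ) ^ 2) with hf
  have hd2 : ∀ k, 0 < (d k / 2).re := fun k => by
    have := hd k
    have e : (d k / 2).re = (d k).re / 2 := by simp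
    rw [e]; positivity
  have hd0 : ∀ k, d k ≠ 0 := fun k h => by have := hd k; simp [h] at this
  have hfi : ∀ k, Integrable (f k) := fun k => by
    refine aux_int _ (hd2 k) _ ?_ ?_
    · simp only [hp]; split_ifs <;> fun_prop
    · intro z
      simp only [hp]
      split_ifs <;> simp <;> nlinarith [sq_nonneg (‖z‖ - 1), sq_nonneg ‖z‖]
  have heq : (fun w : X → ℂ => w u * conj (w v) *
        Complex.exp (-(1/2) * ∑ k, d k * (‖w k‖ : ℂ) ^ 2)) = fun w => ∏ k, f k (w k) := by
    funext w
    simp only [hf, hp, Finset.prod_mul_distrib, Finset.prod_ite_eq', Finset.mem_univ, if_true]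
    rw [← Complex.exp_sum, Finset.mul_sum]
    congr 2
    refine Finset.sum_congr rfl fun k _ => by ring
  constructor
  · rw [heq]; exact Integrable.fintype_prod hfi
  · rw [heq, integral_fintype_prod_volume_eq_prod]
    split_ifs with h
    · subst h
      have hk : ∀ k, ∫ z, f k z = (2 * Real.pi) * (d k)⁻¹ * (if k = u then 2 / d u else 1) := by
        intro k
        have := hd0 k
        by_cases h : k = u
        · subst h
          simp only [hf, hp, if_true]
          rw [aux_m2 _ (hd2 k)]
          field_simp
        · simp only [hf, hp, h, if_false, one_mul, mul_one]
          rw [aux_m0 _ (hd2 k)]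
          field_simp
      simp only [hk, Finset.prod_mul_distrib, Finset.prod_ite_eq', Finset.mem_univ, if_true,
        Finset.prod_const, Finset.card_univ, Finset.prod_inv_distrib, mul_pow]
    · refine Finset.prod_eq_zero (Finset.mem_univ u) ?_
      simp only [hf, hp, h, if_true, if_false, mul_one]
      exact aux_m1 _

lemma aux_gauss {X : Type} [Fintype X] [DecidableEq X] (A : Matrix X X ℂ)
    (hA : ∀ z : X → ℂ, z ≠ 0 → 0 < (star z ⬝ᵥ (A *ᵥ z)).re) (x y : X) :
    A.det ≠ 0 ∧
    ∫ z : X → ℂ, z x * conj (z y) * Complex.exp (-(1/2) * (star z ⬝ᵥ (A *ᵥ z))) =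
      (2 * Real.pi) ^ (Fintype.card X) * (2 * A.det⁻¹ * A⁻¹ x y) := by
  obtain ⟨C, d, hC, hd, hACd⟩ := aux_decomp A hA
  have hd0 : ∀ k, d k ≠ 0 := fun k h => by have := hd k; simp [h] at this
  have hCd : IsUnit C.det := (isUnit_iff_isUnit_det C).1 hC
  have hdetA : A.det = Complex.normSq C.det * ∏ k, d k := by
    rw [hACd, det_mul, det_mul, det_conjTranspose, det_diagonal, Complex.normSq_eq_conj_mul_self,
      Complex.star_def]
    ring
  have hns : (Complex.normSq C.det : ℂ) ≠ 0 := by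
    exact_mod_cast (Complex.normSq_pos.2 hCd.ne_zero).ne'
  have hprod : ∏ k, d k ≠ 0 := Finset.prod_ne_zero_iff.2 fun k _ => hd0 k
  refine ⟨by rw [hdetA]; exact mul_ne_zero hns hprod, ?_⟩
  have hinv : A⁻¹ = C⁻¹ * diagonal (fun k => (d k)⁻¹) * (C⁻¹)ᴴ := by
    refine inv_eq_left_inv ?_
    have e1 : (C⁻¹)ᴴ * Cᴴ = 1 := by
      rw [← conjTranspose_mul, mul_nonsing_inv _ hCd, conjTranspose_one]
    have e2 : diagonal (fun k => (d k)⁻¹) * diagonal d = 1 := by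
      rw [diagonal_mul_diagonal, ← diagonal_one]; congr 1; funext k; exact inv_mul_cancel₀ (hd0 k)
    calc _ = C⁻¹ * (diagonal (fun k => (d k)⁻¹) * (((C⁻¹)ᴴ * Cᴴ) * diagonal d)) * C := by
            rw [hACd]; simp only [Matrix.mul_assoc]
      _ = 1 := by rw [e1, Matrix.one_mul, e2, Matrix.mul_one, nonsing_inv_mul _ hCd]
  have hinvxy : A⁻¹ x y = ∑ u, C⁻¹ x u * conj (C⁻¹ y u) * (d u)⁻¹ := by
    rw [hinv, Matrix.mul_apply]
    refine Finset.sum_congr rfl fun u _ => ?_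
    rw [mul_diagonal, conjTranspose_apply, Complex.star_def]; ring
  set F : (X → ℂ) → ℂ := fun w => (C⁻¹ *ᵥ w) x * conj ((C⁻¹ *ᵥ w) y) *
    Complex.exp (-(1/2) * ∑ k, d k * (‖w k‖ : ℂ) ^ 2) with hF
  have hFC : ∀ z : X → ℂ, z x * conj (z y) * Complex.exp (-(1/2) * (star z ⬝ᵥ (A *ᵥ z))) =
      F (C *ᵥ z) := by
    intro z
    have e1 : C⁻¹ *ᵥ (C *ᵥ z) = z := by
      rw [mulVec_mulVec, nonsing_inv_mul _ hCd, one_mulVec]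
    have e2 : star z ⬝ᵥ (A *ᵥ z) = ∑ k, d k * (‖(C *ᵥ z) k‖ : ℂ) ^ 2 := by
      rw [hACd, ← mulVec_mulVec, ← mulVec_mulVec, dotProduct_mulVec, ← star_mulVec, dotProduct]
      refine Finset.sum_congr rfl fun k _ => ?_
      rw [mulVec_diagonal, ← Complex.ofReal_pow, ← Complex.normSq_eq_norm_sq,
        Complex.normSq_eq_conj_mul_self, Pi.star_apply, Complex.star_def]
      ring
    simp only [hF, e1, e2]
  have hFs : F = fun w => ∑ u, ∑ v, (C⁻¹ x u * conj (C⁻¹ y v)) * (w u * conj (w v) *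
    Complex.exp (-(1/2) * ∑ k, d k * (‖w k‖ : ℂ) ^ 2)) := by
    funext w
    simp only [hF, mulVec, dotProduct, map_sum, map_mul, Finset.sum_mul_sum]
    rw [Finset.sum_mul]
    refine Finset.sum_congr rfl fun u _ => ?_
    rw [Finset.sum_mul]
    refine Finset.sum_congr rfl fun v _ => ?_
    ring
  simp_rw [hFC]
  rw [aux_cov C hC, hFs, integral_finsetSum _ fun u _ => integrable_finsetSum _ fun v _ =>
    ((aux_diag d hd u v).1.const_mul _), hdetA, hinvxy]
  simp_rw [integral_finsetSum Finset.univ fun v _ => ((aux_diag d hd _ v).1.const_mul _),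
    integral_const_mul, (aux_diag d hd _ _).2]
  simp only [mul_ite, mul_zero, Finset.sum_ite_eq, Finset.mem_univ, if_true, Finset.mul_sum]
  refine Finset.sum_congr rfl fun u _ => ?_
  push_cast
  rw [mul_inv]
  ring

/-- Under the mass-gap assumption on the real matrix `L`, for every
`χ : X → [0,∞)` and all `x, y ∈ X`,
`(2π)^{-|X|} ∫ z_x z̄_y exp(-(1/2)⟨z z̄, χ⟩_m + (1/2)⟨L z, z̄⟩_m) ∏ dx dy
  = 2 det(-M_m L + M_{χ m})⁻¹ ((-L + M_χ)⁻¹)_{x y} / m_y`. -/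
theorem stmt1 {X : Type} [Fintype X] [Nonempty X] [DecidableEq X]
    (m : X → ℝ) (hm : ∀ x, 0 < m x) (L : Matrix X X ℝ)
    (ε : ℝ) (hε : 0 < ε)
    (hL : ∀ z : X → ℂ,
      ε * ∑ x, Complex.normSq (z x) * m x ≤
        (∑ x, (-(L.map Complex.ofReal *ᵥ z) x) * conj (z x) * (m x : ℂ)).re)
    (χ : X → ℝ) (hχ : ∀ x, 0 ≤ χ x) (x y : X) :
    (((2 * Real.pi) ^ (Fintype.card X) : ℝ) : ℂ)⁻¹ *
      ∫ z : X → ℂ, z x * conj (z y) *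
        Complex.exp (-(1/2) * ∑ u, z u * conj (z u) * ((χ u * m u : ℝ) : ℂ)
          + (1/2) * ∑ u, (L.map Complex.ofReal *ᵥ z) u * conj (z u) * (m u : ℂ)) =
    2 * (((-(Matrix.diagonal m * L) + Matrix.diagonal (fun u => χ u * m u)).det : ℝ) : ℂ)⁻¹ *
      (((-L + Matrix.diagonal χ)⁻¹ x y : ℝ) : ℂ) / (m y : ℂ) := by
  set A : Matrix X X ℝ := -(Matrix.diagonal m * L) + Matrix.diagonal (fun u => χ u * m u) with hAdef
  have hA : A = Matrix.diagonal m * (-L + Matrix.diagonal χ) := by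
    rw [hAdef, Matrix.mul_add, Matrix.mul_neg, diagonal_mul_diagonal]
    simp only [mul_comm]
  have hquad : ∀ z : X → ℂ, star z ⬝ᵥ (A.map Complex.ofReal *ᵥ z) =
      ∑ u, z u * conj (z u) * ((χ u * m u : ℝ) : ℂ)
        - ∑ u, (L.map Complex.ofReal *ᵥ z) u * conj (z u) * (m u : ℂ) := by
    intro z
    have e : A.map Complex.ofReal = -(diagonal (fun u => (m u : ℂ)) * L.map Complex.ofReal) +
        diagonal (fun u => ((χ u * m u : ℝ) : ℂ)) := by
      ext i j
      by_cases h : i = j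
      · subst h; simp [hAdef]
      · simp [hAdef, h]
    rw [e, add_mulVec, neg_mulVec, dotProduct, ← Finset.sum_sub_distrib]
    refine Finset.sum_congr rfl fun u _ => ?_
    rw [Pi.add_apply, Pi.neg_apply, ← mulVec_mulVec, mulVec_diagonal, mulVec_diagonal,
      Pi.star_apply, Complex.star_def]
    ring
  have hpos : ∀ z : X → ℂ, z ≠ 0 → 0 < (star z ⬝ᵥ (A.map Complex.ofReal *ᵥ z)).re := by
    intro z hz
    have h1 := hL z
    have h2 : 0 < ∑ x, Complex.normSq (z x) * m x := by
      obtain ⟨i, hi⟩ := Function.ne_iff.1 hz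
      refine Finset.sum_pos' (fun j _ => mul_nonneg (Complex.normSq_nonneg _) (hm j).le)
        ⟨i, Finset.mem_univ i, mul_pos (Complex.normSq_pos.2 hi) (hm i)⟩
    have h3 : (∑ u, z u * conj (z u) * ((χ u * m u : ℝ) : ℂ)) =
        ((∑ u, Complex.normSq (z u) * (χ u * m u) : ℝ) : ℂ) := by
      push_cast; refine Finset.sum_congr rfl fun u _ => ?_
      rw [Complex.mul_conj]
    have h4 : 0 ≤ ∑ u, Complex.normSq (z u) * (χ u * m u) :=
      Finset.sum_nonneg fun u _ => mul_nonneg (Complex.normSq_nonneg _) (mul_nonneg (hχ u) (hm u).le)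
    simp only [neg_mul, Finset.sum_neg_distrib, Complex.neg_re] at h1
    rw [hquad, Complex.sub_re, h3, Complex.ofReal_re]
    have := mul_pos hε h2
    linarith
  obtain ⟨hdet, hint⟩ := aux_gauss (A.map Complex.ofReal) hpos x y
  have hdetr : (A.map Complex.ofReal).det = ((A.det : ℝ) : ℂ) :=
    (RingHom.map_det Complex.ofRealHom A).symm
  have hdetA : IsUnit A.det := by
    rw [hdetr] at hdet; exact isUnit_iff_ne_zero.2 (by exact_mod_cast hdet)
  have hinvC : (A.map Complex.ofReal)⁻¹ = (A⁻¹).map Complex.ofReal := by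
    refine inv_eq_left_inv ?_
    have := Matrix.map_mul (L := A⁻¹) (M := A) (f := Complex.ofRealHom)
    rw [nonsing_inv_mul _ hdetA] at this
    exact this.symm.trans (by simp)
  have hmu : (diagonal m)⁻¹ = diagonal (fun u => (m u)⁻¹) := by
    refine inv_eq_left_inv ?_
    rw [diagonal_mul_diagonal, ← diagonal_one]; congr 1; funext k
    exact inv_mul_cancel₀ (hm k).ne'
  have hAinv : A⁻¹ x y = (-L + Matrix.diagonal χ)⁻¹ x y / m y := by
    rw [hA, Matrix.mul_inv_rev, hmu, mul_diagonal, div_eq_mul_inv]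
  have hexp : ∀ z : X → ℂ, -(1/2) * ∑ u, z u * conj (z u) * ((χ u * m u : ℝ) : ℂ)
          + (1/2) * ∑ u, (L.map Complex.ofReal *ᵥ z) u * conj (z u) * (m u : ℂ) =
      -(1/2) * (star z ⬝ᵥ (A.map Complex.ofReal *ᵥ z)) := fun z => by rw [hquad]; ring
  simp_rw [hexp]
  rw [hint, hinvC, map_apply, hAinv, hdetr]
  have hpi : ((2 : ℂ) * Real.pi) ^ Fintype.card X ≠ 0 :=
    pow_ne_zero _ (mul_ne_zero two_ne_zero (by exact_mod_cast Real.pi_ne_zero))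
  push_cast
  rw [inv_mul_cancel_left₀ hpi]
  ring
end

section
/- Let X be a finite nonempty set, m, q : X → (0,∞), let Π be a real X×X matrix with nonnegative entries, set L = M_q(Π − I), and define Π̂ by M_q(Π̂ − I) = M_m^{−1} L^T M_m (so q_x Π̂_{xy} = m_y q_y Π_{yx} / m_x). Then for every z ∈ ℂ^X: Re⟨−Lz, z̄⟩_m = (1/4) Σ_{x,y∈X} m_x q_x (Π_{xy} + Π̂_{xy}) |z_x − z_y|² + Σ_{x∈X} m_x q_x (1 − (1/2) Σ_{y∈X}(Π_{xy} + Π̂_{xy})) |z_x|². In particular, if Π and Π̂ are substochastic (all row sums ≤ 1), then Re⟨−Lz, z̄⟩_m ≥ 0 for all z ∈ ℂ^X. -/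
open Matrix ComplexConjugate

/-- With `L = M_q (Π - I)` and the dual kernel `Π̂` defined by
`M_q (Π̂ - I) = M_m⁻¹ Lᵀ M_m`, the real part of the energy decomposes as
`Re⟨-Lz, z̄⟩_m = (1/4) Σ_{x,y} m_x q_x (Π_{xy} + Π̂_{xy}) |z_x - z_y|²
  + Σ_x m_x q_x (1 - (1/2) Σ_y (Π_{xy} + Π̂_{xy})) |z_x|²`;
in particular it is nonnegative when `Π` and `Π̂` are substochastic. -/
theorem stmt2 {X : Type} [Fintype X] [Nonempty X] [DecidableEq X]
    (m q : X → ℝ) (hm : ∀ x, 0 < m x) (hq : ∀ x, 0 < q x)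
    (P Phat L : Matrix X X ℝ)
    (hP : ∀ x y, 0 ≤ P x y)
    (hL : L = Matrix.diagonal q * (P - 1))
    (hPhat : Matrix.diagonal q * (Phat - 1) = (Matrix.diagonal m)⁻¹ * Lᵀ * Matrix.diagonal m) :
    (∀ z : X → ℂ,
      (∑ x, (-(L.map Complex.ofReal *ᵥ z) x) * conj (z x) * (m x : ℂ)).re =
        (1/4) * ∑ x, ∑ y, m x * q x * (P x y + Phat x y) * Complex.normSq (z x - z y)
        + ∑ x, m x * q x * (1 - (1/2) * ∑ y, (P x y + Phat x y)) * Complex.normSq (z x)) ∧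
    ((∀ x, ∑ y, P x y ≤ 1) → (∀ x, ∑ y, Phat x y ≤ 1) →
      ∀ z : X → ℂ,
        0 ≤ (∑ x, (-(L.map Complex.ofReal *ᵥ z) x) * conj (z x) * (m x : ℂ)).re) := by
  have key : ∀ x y, m x * q x * Phat x y = m y * q y * P y x := by
    intro x y
    have hinv : (Matrix.diagonal m)⁻¹ = Matrix.diagonal (fun x => (m x)⁻¹) := by
      apply Matrix.inv_eq_right_inv
      rw [Matrix.diagonal_mul_diagonal, ← Matrix.diagonal_one]
      congr 1
      funext x
      exact mul_inv_cancel₀ (hm x).ne'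
    have h := congrFun (congrFun hPhat x) y
    rw [hinv, hL] at h
    simp only [Matrix.diagonal_mul, Matrix.mul_diagonal, Matrix.transpose_apply,
      Matrix.sub_apply] at h
    have hx := (hm x).ne'
    have h2 : m x * (q x * (Phat x y - (1 : Matrix X X ℝ) x y))
        = q y * (P y x - (1 : Matrix X X ℝ) y x) * m y := by
      rw [h]; field_simp
    by_cases hxy : x = y
    · subst hxy
      simp only [Matrix.one_apply_eq] at h2
      linarith
    · rw [Matrix.one_apply_ne hxy, Matrix.one_apply_ne (Ne.symm hxy)] at h2
      linarith
  have part1 : ∀ z : X → ℂ,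
      (∑ x, (-(L.map Complex.ofReal *ᵥ z) x) * conj (z x) * (m x : ℂ)).re =
        (1/4) * ∑ x, ∑ y, m x * q x * (P x y + Phat x y) * Complex.normSq (z x - z y)
        + ∑ x, m x * q x * (1 - (1/2) * ∑ y, (P x y + Phat x y)) * Complex.normSq (z x) := by
    intro z
    set N : X → ℝ := fun x => Complex.normSq (z x) with hN
    set R : X → X → ℝ := fun x y => (z x).re * (z y).re + (z x).im * (z y).im with hR
    set a : X → X → ℝ := fun x y => m x * q x * P x y with ha
    have hlhs : (∑ x, (-(L.map Complex.ofReal *ᵥ z) x) * conj (z x) * (m x : ℂ)).re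
        = ∑ x, m x * q x * N x - ∑ x, ∑ y, a x y * R x y := by
      rw [Complex.re_sum, ← Finset.sum_sub_distrib]
      refine Finset.sum_congr rfl fun x _ => ?_
      have e : (L.map Complex.ofReal *ᵥ z) x
          = (q x : ℂ) * ((∑ y, (P x y : ℂ) * z y) - z x) := by
        have : z x = ∑ y, (((1 : Matrix X X ℝ) x y : ℝ) : ℂ) * z y := by
          simp [Matrix.one_apply, apply_ite Complex.ofReal, ite_mul]
        conv_rhs => rw [this]
        rw [← Finset.sum_sub_distrib, Finset.mul_sum, hL]
        simp only [Matrix.mulVec, dotProduct, Matrix.map_apply, Matrix.diagonal_mul,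
          Matrix.sub_apply]
        refine Finset.sum_congr rfl fun y _ => ?_
        push_cast
        ring
      have er : (∑ y, (P x y : ℂ) * z y).re = ∑ y, P x y * (z y).re := by simp
      have ei : (∑ y, (P x y : ℂ) * z y).im = ∑ y, P x y * (z y).im := by simp
      have es : ∑ y, a x y * R x y = m x * q x * ((z x).re * ∑ y, P x y * (z y).re
          + (z x).im * ∑ y, P x y * (z y).im) := by
        rw [Finset.mul_sum, Finset.mul_sum, ← Finset.sum_add_distrib, Finset.mul_sum]
        refine Finset.sum_congr rfl fun y _ => ?_
        simp only [ha, hR]; ring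
      rw [e, es, ← er, ← ei]
      simp only [hN, Complex.normSq_apply]
      generalize (∑ y, (P x y : ℂ) * z y) = w
      simp
      ring
    have h1 : ∑ x, ∑ y, m x * q x * (P x y + Phat x y) * Complex.normSq (z x - z y)
        = ∑ x, ∑ y, a x y * N x + ∑ x, ∑ y, a x y * N y + ∑ x, ∑ y, a y x * N x
          + ∑ x, ∑ y, a y x * N y - 2 * ∑ x, ∑ y, a x y * R x y
          - 2 * ∑ x, ∑ y, a y x * R x y := by
      simp only [Finset.mul_sum, ← Finset.sum_add_distrib, ← Finset.sum_sub_distrib]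
      refine Finset.sum_congr rfl fun x _ => Finset.sum_congr rfl fun y _ => ?_
      rw [mul_add, key x y]
      simp only [ha, hN, hR, Complex.normSq_apply, Complex.sub_re, Complex.sub_im]
      ring
    have h2 : ∑ x, m x * q x * (1 - (1/2) * ∑ y, (P x y + Phat x y)) * Complex.normSq (z x)
        = ∑ x, m x * q x * N x - (1/2) * ∑ x, ∑ y, a x y * N x
          - (1/2) * ∑ x, ∑ y, a y x * N x := by
      rw [Finset.mul_sum, Finset.mul_sum, ← Finset.sum_sub_distrib, ← Finset.sum_sub_distrib]
      refine Finset.sum_congr rfl fun x _ => ?_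
      have e2 : ∑ y, a y x = m x * q x * ∑ y, Phat x y := by
        rw [Finset.mul_sum]
        exact Finset.sum_congr rfl fun y _ => (key x y).symm
      rw [← Finset.sum_mul, ← Finset.sum_mul, e2, Finset.sum_add_distrib]
      simp only [ha, hN]
      rw [← Finset.mul_sum]
      ring
    have c1 : ∑ x, ∑ y, a y x * N x = ∑ x, ∑ y, a x y * N y := Finset.sum_comm
    have c2 : ∑ x, ∑ y, a y x * N y = ∑ x, ∑ y, a x y * N x := Finset.sum_comm
    have c3 : ∑ x, ∑ y, a y x * R x y = ∑ x, ∑ y, a x y * R x y := by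
      rw [Finset.sum_comm]
      refine Finset.sum_congr rfl fun x _ => Finset.sum_congr rfl fun y _ => ?_
      simp only [hR]; ring
    rw [hlhs, h1, h2, c1, c2, c3]
    ring
  refine ⟨part1, fun h1 h2 z => ?_⟩
  rw [part1 z]
  have hmq : ∀ x, 0 < m x * q x := fun x => mul_pos (hm x) (hq x)
  have hPh : ∀ x y, 0 ≤ Phat x y := by
    intro x y
    have : 0 ≤ m x * q x * Phat x y := by
      rw [key x y]; exact mul_nonneg (hmq y).le (hP y x)
    exact nonneg_of_mul_nonneg_right this (hmq x)
  refine add_nonneg (mul_nonneg (by norm_num) ?_) ?_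
  · exact Finset.sum_nonneg fun x _ => Finset.sum_nonneg fun y _ =>
      mul_nonneg (mul_nonneg (hmq x).le (add_nonneg (hP x y) (hPh x y))) (Complex.normSq_nonneg _)
  · refine Finset.sum_nonneg fun x _ => mul_nonneg (mul_nonneg (hmq x).le ?_)
      (Complex.normSq_nonneg _)
    rw [Finset.sum_add_distrib]
    linarith [h1 x, h2 x]
end

section
/- Let X be a finite nonempty set, m, q : X → (0,∞), let Π be a real X×X matrix with nonnegative entries and row sums ≤ 1, set L = M_q(Π − I), and define Π̂ by M_q(Π̂ − I) = M_m^{−1} L^T M_m; assume Π̂ also has row sums ≤ 1, that the nonnegative matrix Π + Π̂ is irreducible, and that there is some x₀ ∈ X with Σ_{y∈X}(Π_{x₀y} + Π̂_{x₀y}) < 2. Then there exists ε > 0 such that Re⟨−Lz, z̄⟩_m ≥ ε⟨z, z̄⟩_m for every z ∈ ℂ^X (a 'mass gap'). -/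
open Matrix ComplexConjugate

theorem gap_of_pos {X : Type} [Fintype X] [Nonempty X] (Q N : (X → ℂ) → ℝ)
    (hQ : Continuous Q) (hN : Continuous N)
    (hQs : ∀ (r : ℝ) z, Q (r • z) = r ^ 2 * Q z) (hNs : ∀ (r : ℝ) z, N (r • z) = r ^ 2 * N z)
    (hQp : ∀ z, z ≠ 0 → 0 < Q z) (hNp : ∀ z, z ≠ 0 → 0 < N z) :
    ∃ ε > (0 : ℝ), ∀ z, ε * N z ≤ Q z := by
  have hne : ∀ z ∈ Metric.sphere (0 : X → ℂ) 1, z ≠ 0 := by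
    intro z hz h
    simp [h] at hz
  obtain ⟨z0, hz0, hmin⟩ := (isCompact_sphere (0 : X → ℂ) 1).exists_isMinOn
    (NormedSpace.sphere_nonempty.2 zero_le_one)
    (f := fun z => Q z / N z)
    (hQ.continuousOn.div hN.continuousOn (fun z hz => (hNp z (hne z hz)).ne'))
  have h0 := hne z0 hz0
  refine ⟨Q z0 / N z0, div_pos (hQp _ h0) (hNp _ h0), fun z => ?_⟩
  by_cases hz : z = 0
  · have h1 := hQs 0 0
    have h2 := hNs 0 0
    simp at h1 h2
    simp [hz, h1, h2]
  · have hn : 0 < ‖z‖ := norm_pos_iff.2 hz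
    have hs : (‖z‖⁻¹ : ℝ) • z ∈ Metric.sphere (0 : X → ℂ) 1 := by
      simp [norm_smul, hn.ne']
    have h := hmin hs
    simp only [Set.mem_ofPred_eq, hQs, hNs] at h
    rw [mul_div_mul_left _ _ (by positivity)] at h
    exact (le_div_iff₀ (hNp z hz)).1 h

/-- With `L = M_q (Π - I)`, `Π` substochastic with nonnegative entries,
the dual kernel `Π̂` (defined by `M_q (Π̂ - I) = M_m⁻¹ Lᵀ M_m`) also substochastic,
`Π + Π̂` irreducible, and strict substochasticity of `Π + Π̂` at some point `x₀`, there is a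
mass gap: `∃ ε > 0` with `Re⟨-Lz, z̄⟩_m ≥ ε ⟨z, z̄⟩_m` for all `z ∈ ℂ^X`. -/
theorem stmt3 {X : Type} [Fintype X] [Nonempty X] [DecidableEq X]
    (m q : X → ℝ) (hm : ∀ x, 0 < m x) (hq : ∀ x, 0 < q x)
    (P Phat L : Matrix X X ℝ)
    (hP : ∀ x y, 0 ≤ P x y)
    (hProw : ∀ x, ∑ y, P x y ≤ 1)
    (hL : L = Matrix.diagonal q * (P - 1))
    (hPhat : Matrix.diagonal q * (Phat - 1) = (Matrix.diagonal m)⁻¹ * Lᵀ * Matrix.diagonal m)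
    (hPhatrow : ∀ x, ∑ y, Phat x y ≤ 1)
    (hirr : ∀ x y : X, x ≠ y → ∃ (k : ℕ) (c : Fin (k + 1) → X),
      c 0 = x ∧ c (Fin.last k) = y ∧ ∀ i : Fin k, 0 < (P + Phat) (c i.castSucc) (c i.succ))
    (hstrict : ∃ x₀ : X, ∑ y, (P x₀ y + Phat x₀ y) < 2) :
    ∃ ε > (0 : ℝ), ∀ z : X → ℂ,
      ε * ∑ x, Complex.normSq (z x) * m x ≤
        (∑ x, (-(L.map Complex.ofReal *ᵥ z) x) * conj (z x) * (m x : ℂ)).re := by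
  have ha : ∀ x, 0 < m x * q x := fun x => mul_pos (hm x) (hq x)
  have hdual : ∀ x y, m x * q x * Phat x y = m y * q y * P y x := by
    intro x y
    have h1 : Matrix.diagonal m * (Matrix.diagonal q * (Phat - 1)) = Lᵀ * Matrix.diagonal m := by
      rw [hPhat, ← mul_assoc, ← mul_assoc, Matrix.mul_nonsing_inv, one_mul]
      rw [Matrix.det_diagonal]
      exact (Finset.prod_pos fun i _ => hm i).ne'.isUnit
    have h2 := congrFun (congrFun h1 x) y
    rw [hL] at h2
    simp only [Matrix.diagonal_mul, Matrix.mul_diagonal, Matrix.transpose_apply,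
      Matrix.sub_apply] at h2
    by_cases hxy : x = y
    · subst hxy
      simp at h2
      linarith
    · rw [Matrix.one_apply_ne hxy, Matrix.one_apply_ne (Ne.symm hxy)] at h2
      linarith
  set Q : (X → ℂ) → ℝ := fun z =>
    (∑ x, (-(L.map Complex.ofReal *ᵥ z) x) * conj (z x) * (m x : ℂ)).re with hQdef
  set N : (X → ℂ) → ℝ := fun z => ∑ x, Complex.normSq (z x) * m x with hNdef
  have hQ : ∀ z, Q z = (1 / 2) * ∑ x, ∑ y, m x * q x * P x y * Complex.normSq (z x - z y)
      + (1 / 2) * ∑ x, m x * q x * (2 - ∑ y, (P x y + Phat x y)) * Complex.normSq (z x) := by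
    intro z
    have e1 : Q z = ∑ x, (m x * q x * Complex.normSq (z x)
        - ∑ y, m x * q x * P x y * (z y * conj (z x)).re) := by
      simp only [hQdef, Complex.re_sum]
      refine Finset.sum_congr rfl fun x _ => ?_
      have : (L.map Complex.ofReal *ᵥ z) x = (q x : ℂ) * (∑ y, (P x y : ℂ) * z y - z x) := by
        simp only [Matrix.mulVec, dotProduct, hL, Matrix.map_apply, Matrix.diagonal_mul,
          Matrix.sub_apply, Complex.ofReal_mul, Complex.ofReal_sub, Matrix.one_apply]
        simp only [mul_assoc, ← Finset.mul_sum, sub_mul, Finset.sum_sub_distrib]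
        simp [apply_ite Complex.ofReal, Finset.sum_ite_eq]
      rw [this]
      have e : -((q x : ℂ) * (∑ y, (P x y : ℂ) * z y - z x)) * conj (z x) * (m x : ℂ)
          = ((m x * q x : ℝ) : ℂ) * (z x * conj (z x))
            - ∑ y, ((m x * q x * P x y : ℝ) : ℂ) * (z y * conj (z x)) := by
        have : ∑ y, ((m x * q x * P x y : ℝ) : ℂ) * (z y * conj (z x))
            = (m x * q x : ℂ) * conj (z x) * ∑ y, (P x y : ℂ) * z y := by
          rw [Finset.mul_sum]
          refine Finset.sum_congr rfl fun y _ => ?_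
          push_cast
          ring
        rw [this]
        push_cast
        ring
      rw [e, Complex.sub_re, Complex.re_sum, Complex.mul_conj]
      simp only [Complex.re_ofReal_mul, Complex.ofReal_re]
    have e2 : ∑ x, m x * q x * (∑ y, Phat x y) * Complex.normSq (z x)
        = ∑ x, ∑ y, m x * q x * P x y * Complex.normSq (z y) := by
      rw [Finset.sum_comm]
      refine Finset.sum_congr rfl fun x _ => ?_
      rw [Finset.mul_sum, Finset.sum_mul]
      refine Finset.sum_congr rfl fun y _ => ?_
      rw [hdual]
    have e3 : ∀ x, m x * q x * (2 - ∑ y, (P x y + Phat x y)) * Complex.normSq (z x)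
        = 2 * (m x * q x * Complex.normSq (z x))
          - ∑ y, m x * q x * P x y * Complex.normSq (z x)
          - m x * q x * (∑ y, Phat x y) * Complex.normSq (z x) := by
      intro x
      rw [Finset.sum_add_distrib, ← Finset.sum_mul, ← Finset.mul_sum]
      ring
    have e4 : ∀ x y, m x * q x * P x y * Complex.normSq (z x - z y)
        = m x * q x * P x y * Complex.normSq (z x) + m x * q x * P x y * Complex.normSq (z y)
          - 2 * (m x * q x * P x y * (z y * conj (z x)).re) := by
      intro x y
      simp only [Complex.normSq_apply, Complex.sub_re, Complex.sub_im, Complex.mul_re,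
        Complex.conj_re, Complex.conj_im]
      ring
    rw [e1]
    rw [Finset.sum_congr rfl fun x _ => e3 x]
    simp only [e4, Finset.sum_sub_distrib, Finset.sum_add_distrib]
    rw [e2]
    simp only [← Finset.mul_sum]
    ring
  have hk : ∀ x, 0 ≤ 2 - ∑ y, (P x y + Phat x y) := by
    intro x
    rw [Finset.sum_add_distrib]
    linarith [hProw x, hPhatrow x]
  have hA : ∀ (z : X → ℂ) x y, 0 ≤ m x * q x * P x y * Complex.normSq (z x - z y) :=
    fun z x y => mul_nonneg (mul_nonneg (ha x).le (hP x y)) (Complex.normSq_nonneg _)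
  have hB : ∀ (z : X → ℂ) x,
      0 ≤ m x * q x * (2 - ∑ y, (P x y + Phat x y)) * Complex.normSq (z x) :=
    fun z x => mul_nonneg (mul_nonneg (ha x).le (hk x)) (Complex.normSq_nonneg _)
  refine gap_of_pos Q N ?_ ?_ ?_ ?_ ?_ ?_
  · rw [show Q = _ from funext hQ]
    have := Complex.continuous_normSq
    fun_prop
  · have := Complex.continuous_normSq
    fun_prop
  · intro r z
    rw [hQ, hQ, mul_add]
    simp only [Pi.smul_apply, Complex.real_smul, ← mul_sub, Complex.normSq_mul,
      Complex.normSq_ofReal, Finset.mul_sum]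
    congr 1
    · refine Finset.sum_congr rfl fun x _ => Finset.sum_congr rfl fun y _ => ?_
      ring
    · refine Finset.sum_congr rfl fun x _ => ?_
      ring
  · intro r z
    simp only [hNdef, Pi.smul_apply, Complex.real_smul, Complex.normSq_mul,
      Complex.normSq_ofReal, Finset.mul_sum]
    refine Finset.sum_congr rfl fun x _ => ?_
    ring
  · intro z hz
    have hA' : 0 ≤ ∑ x, ∑ y, m x * q x * P x y * Complex.normSq (z x - z y) :=
      Finset.sum_nonneg fun x _ => Finset.sum_nonneg fun y _ => hA z x y
    have hB' : 0 ≤ ∑ x, m x * q x * (2 - ∑ y, (P x y + Phat x y)) * Complex.normSq (z x) :=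
      Finset.sum_nonneg fun x _ => hB z x
    by_contra hcon
    rw [hQ] at hcon
    have hA0 : ∑ x, ∑ y, m x * q x * P x y * Complex.normSq (z x - z y) = 0 := by linarith
    have hB0 : ∑ x, m x * q x * (2 - ∑ y, (P x y + Phat x y)) * Complex.normSq (z x) = 0 := by
      linarith
    have hAe : ∀ x y, 0 < P x y → z x = z y := by
      intro x y hxy
      have h1 := (Finset.sum_eq_zero_iff_of_nonneg
        (fun x _ => Finset.sum_nonneg fun y _ => hA z x y)).1 hA0 x (Finset.mem_univ _)
      have h2 := (Finset.sum_eq_zero_iff_of_nonneg (fun y _ => hA z x y)).1 h1 y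
        (Finset.mem_univ _)
      have h3 := (mul_eq_zero.1 h2).resolve_left (mul_pos (ha x) hxy).ne'
      exact sub_eq_zero.1 (Complex.normSq_eq_zero.1 h3)
    obtain ⟨x₀, hx₀⟩ := hstrict
    have hz0 : z x₀ = 0 := by
      have h1 := (Finset.sum_eq_zero_iff_of_nonneg (fun x _ => hB z x)).1 hB0 x₀
        (Finset.mem_univ _)
      have h3 := (mul_eq_zero.1 h1).resolve_left (mul_pos (ha x₀) (by linarith)).ne'
      exact Complex.normSq_eq_zero.1 h3
    have hAe' : ∀ x y, 0 < (P + Phat) x y → z x = z y := by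
      intro x y h
      rw [Matrix.add_apply] at h
      rcases (hP x y).lt_or_eq with h1 | h1
      · exact hAe x y h1
      · have h2 : 0 < Phat x y := by linarith
        have h3 := mul_pos (ha x) h2
        rw [hdual] at h3
        exact (hAe y x (pos_of_mul_pos_right h3 (ha y).le)).symm
    apply hz
    funext y
    by_cases hy : x₀ = y
    · rw [← hy]
      exact hz0
    · obtain ⟨k, c, hc0, hck, hc⟩ := hirr x₀ y hy
      have : ∀ i : Fin (k + 1), z (c i) = 0 := by
        intro i
        induction i using Fin.induction with
        | zero => rw [hc0, hz0]
        | succ i ih => rw [← hAe' _ _ (hc i), ih]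
      rw [← hck]
      exact this _
  · intro z hz
    obtain ⟨x, hx⟩ := Function.ne_iff.1 hz
    refine Finset.sum_pos' (fun x _ => mul_nonneg (Complex.normSq_nonneg _) (hm x).le)
      ⟨x, Finset.mem_univ _, mul_pos (Complex.normSq_pos.2 hx) (hm x)⟩
end

section
/- Let X be a finite nonempty set and let L be a real X×X matrix with L_{xy} ≥ 0 for all x ≠ y, Σ_{y∈X} L_{xy} ≤ 0 for all x, and L invertible. Then for every s : X → [0,∞) the matrix −L + M_s is invertible and all entries of (−L + M_s)^{−1} are nonnegative. -/
open Matrix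

theorem key_aux {X : Type} [Fintype X] [Nonempty X] [DecidableEq X]
    (L : Matrix X X ℝ)
    (hoff : ∀ x y, x ≠ y → 0 ≤ L x y)
    (hrow : ∀ x, ∑ y, L x y ≤ 0)
    (hinv : IsUnit L)
    (s : X → ℝ) (hs : ∀ x, 0 ≤ s x) (v : X → ℝ)
    (hv : ∀ x, 0 ≤ ((-L + Matrix.diagonal s) *ᵥ v) x) (z : X) : 0 ≤ v z := by
  by_contra hz
  push Not at hz
  obtain ⟨a, ha⟩ := Finite.exists_min v
  have hm : v a < 0 := lt_of_le_of_lt (ha z) hz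
  have hL : ∀ x, v x = v a → (∑ y, L x y = 0) ∧ ∀ y, v y ≠ v a → L x y = 0 := by
    intro x hx
    have h1 := hv x
    have h2 : ((-L + Matrix.diagonal s) *ᵥ v) x
        = - (∑ y, L x y * (v y - v a)) - v a * (∑ y, L x y) + s x * v a := by
      rw [Matrix.add_mulVec, Pi.add_apply, Matrix.mulVec_diagonal, hx, Matrix.neg_mulVec,
        Pi.neg_apply]
      simp only [Matrix.mulVec, dotProduct, mul_sub, Finset.sum_sub_distrib]
      rw [← Finset.sum_mul]
      ring
    rw [h2] at h1
    have h3 : ∀ y ∈ Finset.univ, 0 ≤ L x y * (v y - v a) := by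
      intro y _
      by_cases hxy : x = y
      · subst hxy
        simp [hx]
      · exact mul_nonneg (hoff x y hxy) (sub_nonneg.2 (ha y))
    have h4 := Finset.sum_nonneg h3
    have h5 : 0 ≤ v a * ∑ y, L x y := mul_nonneg_of_nonpos_of_nonpos hm.le (hrow x)
    have h6 : s x * v a ≤ 0 := mul_nonpos_of_nonneg_of_nonpos (hs x) hm.le
    have h7 : v a * ∑ y, L x y = 0 := by linarith
    have h8 : ∑ y, L x y * (v y - v a) = 0 := by linarith
    refine ⟨(mul_eq_zero.1 h7).resolve_left hm.ne, fun y hy => ?_⟩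
    have h9 := (Finset.sum_eq_zero_iff_of_nonneg h3).1 h8 y (Finset.mem_univ y)
    exact (mul_eq_zero.1 h9).resolve_right (sub_ne_zero.2 hy)
  obtain ⟨f, hf⟩ := (Matrix.mulVec_surjective_iff_isUnit.2 hinv) (fun _ => (1 : ℝ))
  obtain ⟨x, hxS, hx⟩ := Finset.exists_max_image (Finset.univ.filter fun x => v x = v a) f
    ⟨a, by simp⟩
  simp only [Finset.mem_filter, Finset.mem_univ, true_and] at hxS hx
  obtain ⟨h0, h1⟩ := hL x hxS
  have h2 : ∑ y, L x y * (f y - f x) = 1 := by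
    have := congrFun hf x
    simp only [Matrix.mulVec, dotProduct] at this
    simp only [mul_sub, Finset.sum_sub_distrib]
    rw [← Finset.sum_mul, h0, this]
    ring
  have h3 : ∑ y, L x y * (f y - f x) ≤ 0 := by
    apply Finset.sum_nonpos
    intro y _
    by_cases hy : v y = v a
    · by_cases hxy : x = y
      · subst hxy
        simp
      · exact mul_nonpos_of_nonneg_of_nonpos (hoff x y hxy) (sub_nonpos.2 (hx y hy))
    · simp [h1 y hy]
  linarith

/-- Let `L` be a real `X × X` matrix with nonnegative off-diagonal entries,
nonpositive row sums, and `L` invertible (a sub-generator). Then for every `s : X → [0,∞)`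
the matrix `-L + M_s` is invertible and all entries of its inverse are nonnegative. -/
theorem stmt4 {X : Type} [Fintype X] [Nonempty X] [DecidableEq X]
    (L : Matrix X X ℝ)
    (hoff : ∀ x y, x ≠ y → 0 ≤ L x y)
    (hrow : ∀ x, ∑ y, L x y ≤ 0)
    (hinv : IsUnit L)
    (s : X → ℝ) (hs : ∀ x, 0 ≤ s x) :
    IsUnit (-L + Matrix.diagonal s) ∧
    ∀ x y, 0 ≤ (-L + Matrix.diagonal s)⁻¹ x y := by
  have hu : IsUnit (-L + Matrix.diagonal s) := by
    rw [← Matrix.mulVec_injective_iff_isUnit]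
    intro v w hvw
    have e : (-L + Matrix.diagonal s) *ᵥ (v - w) = 0 := by
      rw [Matrix.mulVec_sub]
      exact sub_eq_zero.2 hvw
    have e' : (-L + Matrix.diagonal s) *ᵥ (w - v) = 0 := by
      rw [Matrix.mulVec_sub]
      exact sub_eq_zero.2 hvw.symm
    funext z
    have h1 := key_aux L hoff hrow hinv s hs (v - w) (fun x => by rw [e]; simp) z
    have h2 := key_aux L hoff hrow hinv s hs (w - v) (fun x => by rw [e']; simp) z
    simp only [Pi.sub_apply] at h1 h2
    linarith
  refine ⟨hu, fun x y => ?_⟩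
  refine key_aux L hoff hrow hinv s hs (fun x => (-L + Matrix.diagonal s)⁻¹ x y) (fun z => ?_) x
  have h := Matrix.mul_nonsing_inv _ ((Matrix.isUnit_iff_isUnit_det _).1 hu)
  have h' := congrFun (congrFun h z) y
  rw [Matrix.mul_apply] at h'
  simp only [Matrix.mulVec, dotProduct]
  rw [h', Matrix.one_apply]
  split_ifs <;> norm_num
end

section
/- Let X be a finite nonempty set and let L be a real X×X matrix with L_{xy} ≥ 0 for all x ≠ y, Σ_{y∈X} L_{xy} ≤ 0 for all x, and L invertible. Define Φ : [0,∞)^X → ℝ by Φ(s) = det(−L)/det(−L + M_s). Then Φ is well defined, smooth on (0,∞)^X, and completely monotone: for every multi-index α ∈ ℕ^X and every s ∈ (0,∞)^X, (−1)^{|α|} (∂^α Φ)(s) ≥ 0. -/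
open Matrix

/-- Iterated partial derivative of a function of finitely many real variables: a list of
coordinates (with multiplicity) encodes a multi-index `α`, and `iterPartial l f` is `∂^α f`. -/
noncomputable def iterPartial {X : Type} [Fintype X] [DecidableEq X] :
    List X → ((X → ℝ) → ℝ) → ((X → ℝ) → ℝ)
  | [], f => f
  | x :: l, f => fun s => fderiv ℝ (iterPartial l f) s (Pi.single x 1)


namespace Stmt5Aux

variable {X : Type} [Fintype X] [DecidableEq X]

lemma maxPrinciple (L : Matrix X X ℝ)
    (hoff : ∀ x y, x ≠ y → 0 ≤ L x y)
    (hrow : ∀ x, ∑ y, L x y ≤ 0)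
    (hinv : IsUnit L) (s : X → ℝ) (hs : ∀ x, 0 ≤ s x) (v : X → ℝ)
    (hv : ∀ x, 0 ≤ ((-L + Matrix.diagonal s) *ᵥ v) x) : ∀ x, 0 ≤ v x := by
  by_contra hcon
  push Not at hcon
  obtain ⟨x0, hx0⟩ := hcon
  haveI : Nonempty X := ⟨x0⟩
  obtain ⟨m, hm⟩ := Finite.exists_min v
  have hmneg : v m < 0 := lt_of_le_of_lt (hm x0) hx0
  obtain ⟨u, hu⟩ : ∃ u : X → ℝ, L *ᵥ u = fun _ => 1 := by
    refine ⟨L⁻¹ *ᵥ (fun _ => 1), ?_⟩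
    rw [Matrix.mulVec_mulVec, Matrix.mul_nonsing_inv _ ((Matrix.isUnit_iff_isUnit_det L).1 hinv),
      Matrix.one_mulVec]
  have key : ∀ x, v x = v m → (∑ y, L x y = 0) ∧ ∀ y, v y ≠ v m → L x y = 0 := by
    intro x hx
    have h1 : ((-L + Matrix.diagonal s) *ᵥ v) x
        = -(∑ y, L x y * (v y - v x)) + (-(∑ y, L x y) + s x) * v x := by
      rw [Matrix.add_mulVec, Pi.add_apply, Matrix.mulVec_diagonal, Matrix.neg_mulVec, Pi.neg_apply]
      simp only [Matrix.mulVec, dotProduct, mul_sub, Finset.sum_sub_distrib, ← Finset.sum_mul]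
      ring
    have hterm : ∀ y ∈ Finset.univ, 0 ≤ L x y * (v y - v x) := by
      intro y _
      by_cases hxy : x = y
      · subst hxy; simp
      · exact mul_nonneg (hoff x y hxy) (by rw [hx]; linarith [hm y])
    have h2 := Finset.sum_nonneg hterm
    have h3 := hv x
    rw [h1] at h3
    have hr := hrow x
    have hsx := hs x
    have hvx : v x < 0 := by rw [hx]; exact hmneg
    have h4 : (∑ y, L x y) = 0 := by
      by_contra hne
      have : 0 < -(∑ y, L x y) + s x := by
        have := lt_of_le_of_ne hr hne
        linarith
      have := mul_neg_of_pos_of_neg this hvx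
      linarith
    refine ⟨h4, ?_⟩
    have h5 : (∑ y, L x y * (v y - v x)) = 0 := by
      have : (-(∑ y, L x y) + s x) * v x ≤ 0 :=
        mul_nonpos_of_nonneg_of_nonpos (by linarith) hvx.le
      linarith
    rw [Finset.sum_eq_zero_iff_of_nonneg hterm] at h5
    intro y hy
    have := h5 y (Finset.mem_univ _)
    rcases mul_eq_zero.1 this with h | h
    · exact h
    · exact absurd (by linarith) hy
  obtain ⟨z, hz, hzmax⟩ := Finset.exists_max_image (Finset.univ.filter fun x => v x = v m) u
    ⟨m, by simp⟩
  simp only [Finset.mem_filter, Finset.mem_univ, true_and] at hz hzmax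
  obtain ⟨k1, k2⟩ := key z hz
  have h6 : ∑ y, L z y * u y = 1 := congrFun hu z
  have h7 : ∑ y, L z y * (u y - u z) = 1 := by
    simp only [mul_sub, Finset.sum_sub_distrib, ← Finset.sum_mul]
    rw [k1, h6]; ring
  have h8 : ∑ y, L z y * (u y - u z) ≤ 0 := by
    apply Finset.sum_nonpos
    intro y _
    by_cases hy : v y = v m
    · by_cases hzy : z = y
      · subst hzy; simp
      · exact mul_nonpos_of_nonneg_of_nonpos (hoff z y hzy) (by linarith [hzmax y hy])
    · rw [k2 y hy]; simp
  linarith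

lemma det_ne (L : Matrix X X ℝ)
    (hoff : ∀ x y, x ≠ y → 0 ≤ L x y)
    (hrow : ∀ x, ∑ y, L x y ≤ 0)
    (hinv : IsUnit L) (s : X → ℝ) (hs : ∀ x, 0 ≤ s x) :
    (-L + Matrix.diagonal s).det ≠ 0 := by
  intro h
  obtain ⟨v, hv, hv0⟩ := Matrix.exists_mulVec_eq_zero_iff.2 h
  apply hv
  have h1 := maxPrinciple L hoff hrow hinv s hs v (by simp [hv0])
  have h2 := maxPrinciple L hoff hrow hinv s hs (-v) (by simp [Matrix.mulVec_neg, hv0])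
  ext x
  have := h1 x
  have := h2 x
  simp only [Pi.neg_apply, Pi.zero_apply] at *
  linarith

lemma inv_nonneg' (L : Matrix X X ℝ)
    (hoff : ∀ x y, x ≠ y → 0 ≤ L x y)
    (hrow : ∀ x, ∑ y, L x y ≤ 0)
    (hinv : IsUnit L) (s : X → ℝ) (hs : ∀ x, 0 ≤ s x) (y z : X) :
    0 ≤ (-L + Matrix.diagonal s)⁻¹ y z := by
  have hd := det_ne L hoff hrow hinv s hs
  refine maxPrinciple L hoff hrow hinv s hs (fun y => (-L + Matrix.diagonal s)⁻¹ y z) ?_ y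
  intro x
  have h : ((-L + Matrix.diagonal s) * (-L + Matrix.diagonal s)⁻¹) x z = (1 : Matrix X X ℝ) x z := by
    rw [Matrix.mul_nonsing_inv _ (isUnit_iff_ne_zero.2 hd)]
  rw [Matrix.mul_apply] at h
  simp only [Matrix.mulVec, dotProduct]
  rw [h, Matrix.one_apply]
  split_ifs <;> norm_num

lemma contDiff_det {n : WithTop ℕ∞} (B : (X → ℝ) → Matrix X X ℝ)
    (hB : ∀ i j, ContDiff ℝ n fun s => B s i j) : ContDiff ℝ n fun s => (B s).det := by
  simp only [Matrix.det_apply]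
  exact ContDiff.sum fun σ _ => ContDiff.const_smul _ (contDiff_prod fun i _ => hB _ _)

lemma contDiff_entry {n : WithTop ℕ∞} (L : Matrix X X ℝ) (i j : X) :
    ContDiff ℝ n fun s : X → ℝ => (-L + Matrix.diagonal s) i j := by
  by_cases h : i = j
  · subst h
    simp only [Matrix.add_apply, Matrix.diagonal_apply_eq]
    fun_prop
  · simp only [Matrix.add_apply, Matrix.diagonal_apply_ne _ h]
    fun_prop

lemma contDiff_adj {n : WithTop ℕ∞} (L : Matrix X X ℝ) (i j : X) :
    ContDiff ℝ n fun s : X → ℝ => (-L + Matrix.diagonal s).adjugate i j := by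
  simp only [Matrix.adjugate_apply]
  apply contDiff_det
  intro a b
  simp only [Matrix.updateRow_apply]
  split_ifs
  · exact contDiff_const
  · exact contDiff_entry L a b

lemma Phi_nonneg (L : Matrix X X ℝ)
    (hoff : ∀ x y, x ≠ y → 0 ≤ L x y)
    (hrow : ∀ x, ∑ y, L x y ≤ 0)
    (hinv : IsUnit L) (s : X → ℝ) (hs : ∀ x, 0 ≤ s x) :
    0 ≤ (-L).det / (-L + Matrix.diagonal s).det := by
  set f : ℝ → ℝ := fun t => (-L).det * (-L + Matrix.diagonal (t • s)).det with hf
  have hc : Continuous f := by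
    have h : Continuous fun s : X → ℝ => (-L + Matrix.diagonal s).det :=
      (contDiff_det (n := 0) _ (contDiff_entry L)).continuous
    exact continuous_const.mul (h.comp (continuous_id.smul continuous_const))
  have hne : (-L).det ≠ 0 := by
    have := det_ne L hoff hrow hinv 0 (by simp)
    simpa using this
  have h0 : 0 < f 0 := by
    simp only [hf, zero_smul, Matrix.diagonal_zero, add_zero]
    have : Matrix.diagonal (0 : X → ℝ) = 0 := Matrix.diagonal_zero
    rw [this, add_zero]
    exact mul_self_pos.2 hne
  have h1 : 0 ≤ f 1 := by
    by_contra hneg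
    push Not at hneg
    obtain ⟨t, ht, hft⟩ := intermediate_value_Icc' (zero_le_one) hc.continuousOn
      (show (0 : ℝ) ∈ Set.Icc (f 1) (f 0) from ⟨hneg.le, h0.le⟩)
    rcases mul_eq_zero.1 hft with h | h
    · exact hne h
    · exact det_ne L hoff hrow hinv (t • s) (fun x => mul_nonneg ht.1 (hs x)) h
  simp only [hf, one_smul] at h1
  rw [div_eq_mul_inv]
  rcases mul_nonneg_iff.1 h1 with ⟨a, b⟩ | ⟨a, b⟩
  · exact mul_nonneg a (inv_nonneg.2 b)
  · exact mul_nonneg_of_nonpos_of_nonpos a (inv_nonpos.2 b)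

/-- The class of functions generated by the resolvent entries and `Φ`. -/
inductive Good (L : Matrix X X ℝ) : ((X → ℝ) → ℝ) → Prop
  | phi : Good L (fun s => (-L).det / (-L + Matrix.diagonal s).det)
  | ent (y z : X) : Good L (fun s => (-L + Matrix.diagonal s)⁻¹ y z)
  | add {f g} : Good L f → Good L g → Good L (fun s => f s + g s)
  | mul {f g} : Good L f → Good L g → Good L (fun s => f s * g s)

lemma fderiv_entry (L : Matrix X X ℝ) (s : X → ℝ) (x i j : X) :
    fderiv ℝ (fun s : X → ℝ => (-L + Matrix.diagonal s) i j) s (Pi.single x 1)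
      = if i = x ∧ j = x then 1 else 0 := by
  by_cases h : i = j
  · subst h
    simp only [Matrix.add_apply, Matrix.diagonal_apply_eq]
    rw [fderiv_const_add, (hasFDerivAt_apply i s).fderiv]
    simp [Pi.single_apply]
  · simp only [Matrix.add_apply, Matrix.diagonal_apply_ne _ h]
    rw [if_neg (by rintro ⟨rfl, rfl⟩; exact h rfl)]
    simp

lemma fderiv_det (L : Matrix X X ℝ) (s : X → ℝ) (x : X) :
    fderiv ℝ (fun s : X → ℝ => (-L + Matrix.diagonal s).det) s (Pi.single x 1)
      = (-L + Matrix.diagonal s).adjugate x x := by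
  have hd : DifferentiableAt ℝ (fun s : X → ℝ => (-L + Matrix.diagonal s).det) s :=
    (contDiff_det (n := 1) _ (contDiff_entry L)).differentiable (by norm_num) s
  rw [← hd.lineDeriv_eq_fderiv]
  apply HasLineDerivAt.lineDeriv
  unfold HasLineDerivAt
  have : (fun t : ℝ => (-L + Matrix.diagonal (s + t • (Pi.single x 1 : X → ℝ))).det)
      = fun t => (-L + Matrix.diagonal s).det + t * (-L + Matrix.diagonal s).adjugate x x := by
    funext t
    have e : (-L + Matrix.diagonal (s + t • (Pi.single x 1 : X → ℝ)))
        = Matrix.updateRow (-L + Matrix.diagonal s) x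
          ((-L + Matrix.diagonal s) x + t • Pi.single x 1) := by
      ext i j
      rw [Matrix.updateRow_apply]
      by_cases hi : i = x
      · subst hi
        by_cases hj : i = j
        · subst hj; simp; ring
        · simp [Matrix.diagonal_apply_ne _ hj, Pi.single_apply, Ne.symm hj]
      · by_cases hj : i = j
        · subst hj; simp [hi]
        · simp [Matrix.diagonal_apply_ne _ hj, hi]
    rw [e, Matrix.det_updateRow_add, Matrix.det_updateRow_smul, Matrix.updateRow_eq_self,
      Matrix.adjugate_apply]
  rw [this]
  simpa using ((hasDerivAt_id (0 : ℝ)).mul_const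
    ((-L + Matrix.diagonal s).adjugate x x)).const_add ((-L + Matrix.diagonal s).det)

lemma diff_ent (L : Matrix X X ℝ) (s : X → ℝ) (hd : (-L + Matrix.diagonal s).det ≠ 0) (y z : X) :
    DifferentiableAt ℝ (fun s : X → ℝ => (-L + Matrix.diagonal s)⁻¹ y z) s := by
  simp only [Matrix.inv_def, Matrix.smul_apply, Ring.inverse_eq_inv', smul_eq_mul]
  exact ((contDiff_det (n := 1) _ (contDiff_entry L)).differentiable (by norm_num) s).inv hd
    |>.mul ((contDiff_adj (n := 1) L y z).differentiable (by norm_num) s)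

lemma isOpen_orthant : IsOpen {s : X → ℝ | ∀ x, 0 < s x} := by
  have : {s : X → ℝ | ∀ x, 0 < s x} = ⋂ x, {s : X → ℝ | 0 < s x} := by ext; simp
  rw [this]
  exact isOpen_iInter_of_finite fun x => isOpen_lt continuous_const (continuous_apply x)

lemma fderiv_ent (L : Matrix X X ℝ)
    (hdet : ∀ s : X → ℝ, (∀ x, 0 ≤ s x) → (-L + Matrix.diagonal s).det ≠ 0)
    (s : X → ℝ) (hs : ∀ x, 0 < s x) (x y z : X) :
    fderiv ℝ (fun s : X → ℝ => (-L + Matrix.diagonal s)⁻¹ y z) s (Pi.single x 1)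
      = -((-L + Matrix.diagonal s)⁻¹ y x * (-L + Matrix.diagonal s)⁻¹ x z) := by
  have hd := hdet s fun x => (hs x).le
  set D : X → ℝ := fun w =>
    fderiv ℝ (fun s : X → ℝ => (-L + Matrix.diagonal s)⁻¹ w z) s (Pi.single x 1) with hD
  have hdA : ∀ i j, DifferentiableAt ℝ (fun s : X → ℝ => (-L + Matrix.diagonal s) i j) s :=
    fun i j => (contDiff_entry (n := 1) L i j).differentiable (by norm_num) s
  have h1 : (-L + Matrix.diagonal s) *ᵥ D
      = -((-L + Matrix.diagonal s)⁻¹ x z • Pi.single x 1) := by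
    funext i
    have hev : (fun s : X → ℝ => ∑ w, (-L + Matrix.diagonal s) i w * (-L + Matrix.diagonal s)⁻¹ w z)
        =ᶠ[nhds s] fun _ => (1 : Matrix X X ℝ) i z := by
      filter_upwards [isOpen_orthant.mem_nhds hs] with s' hs'
      rw [← Matrix.mul_apply, Matrix.mul_nonsing_inv _
        (isUnit_iff_ne_zero.2 (hdet s' fun x => (hs' x).le))]
    have h2 := hev.fderiv_eq (𝕜 := ℝ)
    have h3 := DFunLike.congr_fun h2 (Pi.single x 1)
    rw [fderiv_fun_sum (fun w _ => (hdA i w).fun_mul (diff_ent L s hd w z))] at h3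
    rw [ContinuousLinearMap.sum_apply] at h3
    have h4 : ∀ w, fderiv ℝ (fun s : X → ℝ => (-L + Matrix.diagonal s) i w *
        (-L + Matrix.diagonal s)⁻¹ w z) s (Pi.single x 1)
        = (-L + Matrix.diagonal s) i w * D w
          + (if i = x ∧ w = x then 1 else 0) * (-L + Matrix.diagonal s)⁻¹ w z := by
      intro w
      rw [fderiv_fun_mul (hdA i w) (diff_ent L s hd w z), _root_.add_apply,
        _root_.smul_apply, _root_.smul_apply, fderiv_entry,
        smul_eq_mul, smul_eq_mul, mul_comm ((-L + Matrix.diagonal s)⁻¹ w z)]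
    simp only [h4, Finset.sum_add_distrib] at h3
    have h5 : ∑ w, (if i = x ∧ w = x then (1 : ℝ) else 0) * (-L + Matrix.diagonal s)⁻¹ w z
        = (-L + Matrix.diagonal s)⁻¹ x z * (Pi.single x 1 : X → ℝ) i := by
      by_cases hi : i = x
      · subst hi; simp
      · simp [hi]
    rw [h5] at h3
    simp only [fderiv_fun_const, Pi.zero_apply, _root_.zero_apply] at h3
    simp only [Matrix.mulVec, dotProduct, Pi.neg_apply, Pi.smul_apply, smul_eq_mul]
    linarith
  have h6 := congrArg (fun v => (-L + Matrix.diagonal s)⁻¹ *ᵥ v) h1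
  simp only [Matrix.mulVec_mulVec] at h6
  rw [Matrix.nonsing_inv_mul _ (isUnit_iff_ne_zero.2 hd), Matrix.one_mulVec] at h6
  have h7 := congrFun h6 y
  rw [Matrix.mulVec_neg, Matrix.mulVec_smul, Matrix.mulVec_single_one] at h7
  simp only [Pi.neg_apply, Pi.smul_apply, smul_eq_mul, Matrix.col_apply] at h7
  rw [mul_comm]
  exact h7

lemma good_spec (L : Matrix X X ℝ)
    (hoff : ∀ x y, x ≠ y → 0 ≤ L x y)
    (hrow : ∀ x, ∑ y, L x y ≤ 0)
    (hinv : IsUnit L) {f : (X → ℝ) → ℝ} (hf : Good L f) :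
    (∀ s : X → ℝ, (∀ x, 0 < s x) → 0 ≤ f s ∧ DifferentiableAt ℝ f s) ∧
    ∀ x, ∃ g, Good L g ∧ ∀ s : X → ℝ, (∀ x, 0 < s x) → fderiv ℝ f s (Pi.single x 1) = - g s := by
  have hdet := det_ne L hoff hrow hinv
  have hdd : ∀ s : X → ℝ, DifferentiableAt ℝ (fun s : X → ℝ => (-L + Matrix.diagonal s).det) s :=
    (contDiff_det (n := 1) _ (contDiff_entry L)).differentiable (by norm_num)
  induction hf with
  | phi =>
    refine ⟨fun s hs => ⟨Phi_nonneg L hoff hrow hinv s fun x => (hs x).le,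
      by simpa only [div_eq_mul_inv] using
        ((hdd s).fun_inv (hdet s fun x => (hs x).le)).const_mul (-L).det⟩, fun x =>
      ⟨_, Good.mul Good.phi (Good.ent x x), fun s hs => ?_⟩⟩
    have hd := hdet s fun x => (hs x).le
    simp only [div_eq_mul_inv]
    rw [fderiv_const_mul ((hdd s).fun_inv hd)]
    have h := ((hasDerivAt_inv hd).comp_hasFDerivAt s (hdd s).hasFDerivAt).fderiv
    simp only [Function.comp_def] at h
    rw [h]
    simp only [_root_.smul_apply, smul_eq_mul, fderiv_det, Matrix.inv_def, Matrix.smul_apply,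
      Ring.inverse_eq_inv']
    field_simp
  | ent y z =>
    exact ⟨fun s hs => ⟨inv_nonneg' L hoff hrow hinv s (fun x => (hs x).le) y z,
      diff_ent L s (hdet s fun x => (hs x).le) y z⟩, fun x =>
      ⟨_, Good.mul (Good.ent y x) (Good.ent x z), fun s hs => fderiv_ent L hdet s hs x y z⟩⟩
  | add hf hg ihf ihg =>
    refine ⟨fun s hs => ⟨add_nonneg (ihf.1 s hs).1 (ihg.1 s hs).1,
      (ihf.1 s hs).2.add (ihg.1 s hs).2⟩, fun x => ?_⟩
    obtain ⟨f', hf', h1⟩ := ihf.2 x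
    obtain ⟨g', hg', h2⟩ := ihg.2 x
    refine ⟨_, Good.add hf' hg', fun s hs => ?_⟩
    rw [fderiv_fun_add (ihf.1 s hs).2 (ihg.1 s hs).2, _root_.add_apply, h1 s hs, h2 s hs]
    ring
  | @mul f g hf hg ihf ihg =>
    refine ⟨fun s hs => ⟨mul_nonneg (ihf.1 s hs).1 (ihg.1 s hs).1,
      (ihf.1 s hs).2.mul (ihg.1 s hs).2⟩, fun x => ?_⟩
    obtain ⟨f', hf', h1⟩ := ihf.2 x
    obtain ⟨g', hg', h2⟩ := ihg.2 x
    refine ⟨_, Good.add (Good.mul hf hg') (Good.mul hg hf'), fun s hs => ?_⟩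
    rw [fderiv_fun_mul (ihf.1 s hs).2 (ihg.1 s hs).2, _root_.add_apply, _root_.smul_apply,
      _root_.smul_apply, h1 s hs, h2 s hs, smul_eq_mul, smul_eq_mul]
    ring

lemma iter_good (L : Matrix X X ℝ)
    (hoff : ∀ x y, x ≠ y → 0 ≤ L x y)
    (hrow : ∀ x, ∑ y, L x y ≤ 0)
    (hinv : IsUnit L) (l : List X) :
    ∃ g, Good L g ∧ ∀ s : X → ℝ, (∀ x, 0 < s x) →
      iterPartial l (fun s : X → ℝ => (-L).det / (-L + Matrix.diagonal s).det) s
        = (-1) ^ l.length * g s := by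
  induction l with
  | nil => exact ⟨_, Good.phi, fun s _ => by simp [iterPartial]⟩
  | cons x l ih =>
    obtain ⟨g, hg, h⟩ := ih
    obtain ⟨hg1, hg2⟩ := good_spec L hoff hrow hinv hg
    obtain ⟨g', hg', h'⟩ := hg2 x
    refine ⟨g', hg', fun s hs => ?_⟩
    have hev : iterPartial l (fun s : X → ℝ => (-L).det / (-L + Matrix.diagonal s).det)
        =ᶠ[nhds s] fun s => (-1) ^ l.length * g s := by
      filter_upwards [isOpen_orthant.mem_nhds hs] with s' hs' using h s' hs'
    simp only [iterPartial]
    rw [hev.fderiv_eq, fderiv_const_mul (hg1 s hs).2, _root_.smul_apply, h' s hs, smul_eq_mul,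
      List.length_cons, pow_succ]
    ring

end Stmt5Aux

/-- Let `L` be a real sub-generator matrix (nonnegative off-diagonal entries,
nonpositive row sums) which is invertible, and `Φ(s) = det(-L) / det(-L + M_s)`. Then `Φ` is
well defined on `[0,∞)^X` (the denominator does not vanish), smooth on `(0,∞)^X`, and
completely monotone: for every multi-index `α` (encoded as a list of coordinates with
multiplicities) and every `s ∈ (0,∞)^X`, `(-1)^{|α|} ∂^α Φ(s) ≥ 0`. -/
theorem stmt5 {X : Type} [Fintype X] [Nonempty X] [DecidableEq X]
    (L : Matrix X X ℝ)
    (hoff : ∀ x y, x ≠ y → 0 ≤ L x y)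
    (hrow : ∀ x, ∑ y, L x y ≤ 0)
    (hinv : IsUnit L) :
    (∀ s : X → ℝ, (∀ x, 0 ≤ s x) → (-L + Matrix.diagonal s).det ≠ 0) ∧
    ContDiffOn ℝ (⊤ : ℕ∞) (fun s : X → ℝ => (-L).det / (-L + Matrix.diagonal s).det)
      {s : X → ℝ | ∀ x, 0 < s x} ∧
    (∀ (l : List X) (s : X → ℝ), (∀ x, 0 < s x) →
      0 ≤ (-1 : ℝ) ^ l.length *
        iterPartial l (fun s : X → ℝ => (-L).det / (-L + Matrix.diagonal s).det) s) := by
  have hdet := Stmt5Aux.det_ne L hoff hrow hinv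
  refine ⟨hdet, ?_, ?_⟩
  · exact contDiffOn_const.div
      (Stmt5Aux.contDiff_det _ (Stmt5Aux.contDiff_entry L)).contDiffOn
      (fun s hs => hdet s fun x => (hs x).le)
  · intro l s hs
    obtain ⟨g, hg, h⟩ := Stmt5Aux.iter_good L hoff hrow hinv l
    rw [h s hs, ← mul_assoc, ← mul_pow]
    simpa using ((Stmt5Aux.good_spec L hoff hrow hinv hg).1 s hs).1
end

section
/- Let X be a finite nonempty set and let L be a real X×X matrix with L_{xy} ≥ 0 for all x ≠ y, Σ_{y∈X} L_{xy} ≤ 0 for all x, and L invertible. Define Φ(s) = det(−L)/det(−L + M_s) for s ∈ [0,∞)^X. Then for every real t > 0 the fractional power Φ^t is completely monotone: Φ(s) > 0 for all s ∈ [0,∞)^X and for every multi-index α ∈ ℕ^X and every s ∈ (0,∞)^X, (−1)^{|α|} ∂^α (Φ^t)(s) ≥ 0. (This expresses the infinite divisibility of the corresponding distribution.) -/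
open Matrix

section helpers
variable {X : Type} [Fintype X] [DecidableEq X]

lemma zm_pos {A : Matrix X X ℝ} (hoff : ∀ x y, x ≠ y → A x y ≤ 0)
    (hrow : ∀ x, 0 < ∑ y, A x y) (v : X → ℝ) (hv : ∀ x, 0 ≤ (A *ᵥ v) x) (z : X) : 0 ≤ v z := by
  have : Nonempty X := ⟨z⟩
  obtain ⟨x, hx⟩ := Finite.exists_min v
  refine le_trans ?_ (hx z)
  by_contra hneg
  push Not at hneg
  have h1 : (A *ᵥ v) x ≤ ∑ y, A x y * v x := by
    simp only [Matrix.mulVec, dotProduct]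
    refine Finset.sum_le_sum fun y _ => ?_
    by_cases h : x = y
    · subst h; exact le_rfl
    · nlinarith [hoff x y h, hx y]
  rw [← Finset.sum_mul] at h1
  nlinarith [hv x, hrow x]

lemma zm_det_ne {A : Matrix X X ℝ} (hoff : ∀ x y, x ≠ y → A x y ≤ 0)
    (hrow : ∀ x, 0 < ∑ y, A x y) : A.det ≠ 0 := by
  intro h
  obtain ⟨v, hv, hAv⟩ := Matrix.exists_mulVec_eq_zero_iff.mpr h
  apply hv
  ext z
  refine le_antisymm ?_ (zm_pos hoff hrow v (by simp [hAv]) z)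
  have := zm_pos hoff hrow (-v) (by simp [Matrix.mulVec_neg, hAv]) z
  simpa using this

lemma zm_det_pos {A : Matrix X X ℝ} (hoff : ∀ x y, x ≠ y → A x y ≤ 0)
    (hrow : ∀ x, 0 < ∑ y, A x y) : 0 < A.det := by
  have hc : ContinuousOn (fun r : ℝ => ((1 - r) • (1 : Matrix X X ℝ) + r • A).det)
      (Set.Icc 0 1) := by
    apply Continuous.continuousOn
    apply Continuous.matrix_det
    fun_prop
  have hne : ∀ r ∈ Set.Icc (0:ℝ) 1, ((1 - r) • (1 : Matrix X X ℝ) + r • A).det ≠ 0 := by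
    intro r hr
    apply zm_det_ne
    · intro x y h
      simp [Matrix.one_apply, h]
      nlinarith [hoff x y h, hr.1]
    · intro x
      simp only [Matrix.add_apply, Matrix.smul_apply, Finset.sum_add_distrib, smul_eq_mul, ← Finset.mul_sum,
        Matrix.one_apply, Finset.sum_ite_eq, Finset.mem_univ, if_true]
      rcases eq_or_lt_of_le hr.1 with h | h
      · subst h; simp
      · nlinarith [hr.2, mul_pos h (hrow x)]
  by_contra hcon
  push Not at hcon
  have := intermediate_value_Icc' (zero_le_one' ℝ) hc
  obtain ⟨r, hr, hr0⟩ := this (show (0:ℝ) ∈ Set.Icc _ _ by simpa using hcon)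
  exact hne r hr hr0

lemma zm_inv_nonneg {A : Matrix X X ℝ} (hoff : ∀ x y, x ≠ y → A x y ≤ 0)
    (hrow : ∀ x, 0 < ∑ y, A x y) (y z : X) : 0 ≤ A⁻¹ y z := by
  have hu : IsUnit A.det := (zm_det_ne hoff hrow).isUnit
  refine zm_pos hoff hrow (fun w => A⁻¹ w z) (fun x => ?_) y
  have : (A *ᵥ fun w => A⁻¹ w z) x = (A * A⁻¹) x z := rfl
  rw [this, Matrix.mul_nonsing_inv _ hu, Matrix.one_apply]
  split_ifs <;> norm_num

lemma zm_adj {A : Matrix X X ℝ} (hA : A.det ≠ 0) (y z : X) :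
    A.adjugate y z = A.det * A⁻¹ y z := by
  rw [Matrix.inv_def]
  simp [hA]

lemma zm_weak_eps {A : Matrix X X ℝ} (hoff : ∀ x y, x ≠ y → A x y ≤ 0)
    (hrow : ∀ x, 0 ≤ ∑ y, A x y) (e : ℝ) (he : 0 < e) :
    (∀ x y, x ≠ y → (A + e • (1 : Matrix X X ℝ)) x y ≤ 0) ∧
      ∀ x, 0 < ∑ y, (A + e • (1 : Matrix X X ℝ)) x y := by
  constructor
  · intro x y h
    simpa [Matrix.one_apply, h] using hoff x y h
  · intro x
    simp only [Matrix.add_apply, Matrix.smul_apply, Finset.sum_add_distrib, smul_eq_mul, ← Finset.mul_sum,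
        Matrix.one_apply, Finset.sum_ite_eq, Finset.mem_univ, if_true]
    linarith [hrow x]

lemma zm_lim {f : ℝ → ℝ} (hf : Continuous f) (h : ∀ e, 0 < e → 0 ≤ f e) : 0 ≤ f 0 := by
  have h1 : Filter.Tendsto f (nhdsWithin 0 (Set.Ioi 0)) (nhds (f 0)) :=
    (hf.tendsto 0).mono_left nhdsWithin_le_nhds
  refine ge_of_tendsto h1 ?_
  filter_upwards [self_mem_nhdsWithin] with e he using h e he

lemma zm_det_nonneg {A : Matrix X X ℝ} (hoff : ∀ x y, x ≠ y → A x y ≤ 0)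
    (hrow : ∀ x, 0 ≤ ∑ y, A x y) : 0 ≤ A.det := by
  have := zm_lim (f := fun e : ℝ => (A + e • (1 : Matrix X X ℝ)).det)
    (by apply Continuous.matrix_det; fun_prop)
    (fun e he => (zm_det_pos (zm_weak_eps hoff hrow e he).1 (zm_weak_eps hoff hrow e he).2).le)
  simpa using this

lemma zm_adj_nonneg {A : Matrix X X ℝ} (hoff : ∀ x y, x ≠ y → A x y ≤ 0)
    (hrow : ∀ x, 0 ≤ ∑ y, A x y) (y z : X) : 0 ≤ A.adjugate y z := by
  have := zm_lim (f := fun e : ℝ => (A + e • (1 : Matrix X X ℝ)).adjugate y z)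
    (by
      apply Continuous.matrix_elem
      apply Continuous.matrix_adjugate; fun_prop)
    (fun e he => by
      obtain ⟨h1, h2⟩ := zm_weak_eps hoff hrow e he
      show 0 ≤ (A + e • (1 : Matrix X X ℝ)).adjugate y z
      rw [zm_adj (zm_det_ne h1 h2)]
      exact mul_nonneg (zm_det_pos h1 h2).le (zm_inv_nonneg h1 h2 y z))
  simpa using this

lemma det_add_single (A : Matrix X X ℝ) (x : X) (c : ℝ) :
    (A + Matrix.diagonal (Pi.single x c)).det = A.det + c * A.adjugate x x := by
  have : A + Matrix.diagonal (Pi.single x c) =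
      A.updateRow x (A x + c • (Pi.single x 1 : X → ℝ)) := by
    ext i j
    by_cases hi : i = x
    · subst hi
      by_cases hj : i = j
      · subst hj; simp
      · simp [hj, Ne.symm hj]
    · by_cases hj : i = j
      · subst hj; simp [hi]
      · simp [hi, hj]
  rw [this, Matrix.det_updateRow_add, Matrix.det_updateRow_smul, Matrix.updateRow_eq_self,
    Matrix.adjugate_apply]

lemma zm_det_mono {A : Matrix X X ℝ} (hoff : ∀ x y, x ≠ y → A x y ≤ 0)
    (hrow : ∀ x, 0 ≤ ∑ y, A x y) (s : X → ℝ) (hs : ∀ x, 0 ≤ s x) (S : Finset X) :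
    A.det ≤ (A + Matrix.diagonal (∑ x ∈ S, Pi.single x (s x))).det := by
  induction S using Finset.induction_on with
  | empty => simp
  | insert a S ha ih =>
    have hsp : A + Matrix.diagonal (∑ x ∈ insert a S, Pi.single x (s x)) =
        (A + Matrix.diagonal (∑ x ∈ S, Pi.single x (s x))) +
          Matrix.diagonal (Pi.single a (s a)) := by
      rw [Finset.sum_insert ha, add_assoc, Matrix.diagonal_add]
      congr 2
      exact add_comm _ _
    rw [hsp, det_add_single]
    have hnn : ∀ x, 0 ≤ (∑ z ∈ S, Pi.single z (s z) : X → ℝ) x := by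
      intro x
      rw [Finset.sum_apply]
      refine Finset.sum_nonneg fun z _ => ?_
      by_cases h : x = z
      · subst h; simpa using hs x
      · simp [h]
    have := zm_adj_nonneg (A := A + Matrix.diagonal (∑ x ∈ S, Pi.single x (s x)))
      (fun x y h => by simpa [h] using hoff x y h)
      (fun x => by
        simp only [Matrix.add_apply, Finset.sum_add_distrib, Matrix.diagonal_apply,
          Finset.sum_ite_eq, Finset.mem_univ, if_true]
        exact add_nonneg (hrow x) (hnn x)) a a
    nlinarith [mul_nonneg (hs a) this]

lemma zm_det_mono' {A : Matrix X X ℝ} (hoff : ∀ x y, x ≠ y → A x y ≤ 0)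
    (hrow : ∀ x, 0 ≤ ∑ y, A x y) (s : X → ℝ) (hs : ∀ x, 0 ≤ s x) :
    A.det ≤ (A + Matrix.diagonal s).det := by
  have := zm_det_mono hoff hrow s hs Finset.univ
  rwa [Finset.univ_sum_single] at this

inductive CMc (A : Matrix X X ℝ) (F : (X → ℝ) → ℝ) : ((X → ℝ) → ℝ) → Prop
  | base : CMc A F F
  | green (y z : X) : CMc A F (fun s => (A + Matrix.diagonal s)⁻¹ y z)
  | const (c : ℝ) (hc : 0 ≤ c) : CMc A F (fun _ => c)
  | add {f g} : CMc A F f → CMc A F g → CMc A F (fun s => f s + g s)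
  | mul {f g} : CMc A F f → CMc A F g → CMc A F (fun s => f s * g s)

lemma isOpen_posO : IsOpen {s : X → ℝ | ∀ x, 0 < s x} := by
  simp only [Set.ofPred_forall]
  exact isOpen_iInter_of_finite fun x => isOpen_lt continuous_const (continuous_apply x)

lemma fderiv_dir {f : (X → ℝ) → ℝ} {s : X → ℝ} (hf : DifferentiableAt ℝ f s) (x : X) {d : ℝ}
    (h : HasDerivAt (fun r : ℝ => f (s + r • (Pi.single x 1 : X → ℝ))) d 0) :
    fderiv ℝ f s (Pi.single x 1) = d :=
  (hf.hasFDerivAt.hasLineDerivAt (Pi.single x 1)).unique h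

lemma diff_det {B : (X → ℝ) → Matrix X X ℝ} (h : ∀ i j, Differentiable ℝ fun s => B s i j) :
    Differentiable ℝ fun s => (B s).det := by
  simp only [Matrix.det_apply]
  fun_prop

lemma diff_green (A : Matrix X X ℝ) {s : X → ℝ} (hs : (A + Matrix.diagonal s).det ≠ 0) (y z : X) :
    DifferentiableAt ℝ (fun s => (A + Matrix.diagonal s)⁻¹ y z) s := by
  have hent : ∀ i j, Differentiable ℝ fun s : X → ℝ => (A + Matrix.diagonal s) i j := by
    intro i j
    by_cases h : i = j
    · subst h; simp; fun_prop
    · simp [h]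
  have h1 : Differentiable ℝ fun s => (A + Matrix.diagonal s).det := diff_det hent
  have h2 : Differentiable ℝ fun s => (A + Matrix.diagonal s).adjugate y z := by
    simp only [Matrix.adjugate_apply]
    apply diff_det
    intro i j
    by_cases h : i = z
    · subst h; simp
    · simpa [Matrix.updateRow_apply, h] using hent i j
  have : (fun s => (A + Matrix.diagonal s)⁻¹ y z) =
      fun s => ((A + Matrix.diagonal s).det)⁻¹ * (A + Matrix.diagonal s).adjugate y z := by
    ext s; simp [Matrix.inv_def]
  rw [this]
  exact ((h1 s).inv hs).mul (h2 s)

lemma diff_detA (A : Matrix X X ℝ) : Differentiable ℝ fun s => (A + Matrix.diagonal s).det := by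
  apply diff_det
  intro i j
  by_cases h : i = j
  · subst h; simp; fun_prop
  · simp [h]

lemma shift_eq (A : Matrix X X ℝ) (s : X → ℝ) (r : ℝ) (x : X) :
    A + Matrix.diagonal (s + r • (Pi.single x 1 : X → ℝ)) =
      (A + Matrix.diagonal s) + Matrix.diagonal (Pi.single x r) := by
  rw [add_assoc, Matrix.diagonal_add, ← Pi.single_smul]
  simp

lemma fderiv_det (A : Matrix X X ℝ) (s : X → ℝ) (x : X) :
    fderiv ℝ (fun s => (A + Matrix.diagonal s).det) s (Pi.single x 1) =
      (A + Matrix.diagonal s).adjugate x x := by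
  apply fderiv_dir (diff_detA A s)
  simp only [shift_eq, det_add_single]
  simpa using ((hasDerivAt_id (0:ℝ)).mul_const
    ((A + Matrix.diagonal s).adjugate x x)).const_add (A + Matrix.diagonal s).det

lemma fderiv_green (A : Matrix X X ℝ) {s : X → ℝ} (hs : (A + Matrix.diagonal s).det ≠ 0)
    (x y z : X) :
    fderiv ℝ (fun s => (A + Matrix.diagonal s)⁻¹ y z) s (Pi.single x 1) =
      -((A + Matrix.diagonal s)⁻¹ y x * (A + Matrix.diagonal s)⁻¹ x z) := by
  apply fderiv_dir (diff_green A hs y z)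
  set p : ℝ → (X → ℝ) := fun r => s + r • (Pi.single x 1 : X → ℝ) with hp
  have hp0 : p 0 = s := by simp [hp]
  have hpd : DifferentiableAt ℝ p 0 := by simp only [hp]; fun_prop
  have hG : DifferentiableAt ℝ (fun r => (A + Matrix.diagonal (p r))⁻¹ y x) 0 := by
    have := diff_green A (s := p 0) (by rwa [hp0]) y x
    exact this.comp (0:ℝ) hpd
  have hev : ∀ᶠ r in nhds (0:ℝ), (A + Matrix.diagonal (p r)).det ≠ 0 := by
    have hc : ContinuousAt (fun r => (A + Matrix.diagonal (p r)).det) 0 :=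
      ((diff_detA A (p 0)).comp (0:ℝ) hpd).continuousAt
    exact hc.eventually_ne (by rwa [hp0])
  have key : (fun r => (A + Matrix.diagonal (p r))⁻¹ y z) =ᶠ[nhds 0] fun r =>
      (A + Matrix.diagonal s)⁻¹ y z -
        r * ((A + Matrix.diagonal (p r))⁻¹ y x * (A + Matrix.diagonal s)⁻¹ x z) := by
    filter_upwards [hev] with r hr
    have e1 := Matrix.nonsing_inv_mul _ hr.isUnit
    have e2 := Matrix.mul_nonsing_inv _ hs.isUnit
    have e3 : A + Matrix.diagonal (p r) = (A + Matrix.diagonal s) + Matrix.diagonal (Pi.single x r) :=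
      shift_eq A s r x
    set P := A + Matrix.diagonal (p r) with hP
    set Q := A + Matrix.diagonal s with hQ
    have e4 : P⁻¹ = Q⁻¹ - P⁻¹ * Matrix.diagonal (Pi.single x r) * Q⁻¹ := by
      have : Matrix.diagonal (Pi.single x r) = P - Q := by rw [e3]; abel
      rw [this, mul_sub, sub_mul, e1, mul_assoc, e2]
      simp
    have e5 := congrFun (congrFun e4 y) z
    rw [e5, Matrix.sub_apply, Matrix.mul_apply]
    simp only [Matrix.mul_diagonal]
    rw [Finset.sum_eq_single x]
    · simp; ring
    · intro b _ hb; simp [hb]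
    · simp
  have hd : HasDerivAt (fun r => (A + Matrix.diagonal s)⁻¹ y z -
        r * ((A + Matrix.diagonal (p r))⁻¹ y x * (A + Matrix.diagonal s)⁻¹ x z))
      (-((A + Matrix.diagonal s)⁻¹ y x * (A + Matrix.diagonal s)⁻¹ x z)) 0 := by
    have := ((hasDerivAt_id (0:ℝ)).mul (hG.hasDerivAt.mul_const
      ((A + Matrix.diagonal s)⁻¹ x z))).const_sub ((A + Matrix.diagonal s)⁻¹ y z)
    simpa [hp0] using this
  exact hd.congr_of_eventuallyEq key

lemma CMc_main {A : Matrix X X ℝ} {F : (X → ℝ) → ℝ}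
    (hdet : ∀ s : X → ℝ, (∀ x, 0 < s x) → (A + Matrix.diagonal s).det ≠ 0)
    (hF : ∀ s : X → ℝ, (∀ x, 0 < s x) → DifferentiableAt ℝ F s)
    (t : ℝ) (ht : 0 < t)
    (hF' : ∀ s : X → ℝ, (∀ x, 0 < s x) → ∀ x, fderiv ℝ F s (Pi.single x 1) =
      -(t * (A + Matrix.diagonal s)⁻¹ x x * F s))
    {f : (X → ℝ) → ℝ} (hf : CMc A F f) :
    (∀ s : X → ℝ, (∀ x, 0 < s x) → DifferentiableAt ℝ f s) ∧
    ∀ x, ∃ g, CMc A F g ∧ ∀ s : X → ℝ, (∀ x, 0 < s x) →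
      fderiv ℝ f s (Pi.single x 1) = - g s := by
  induction hf with
  | base =>
    exact ⟨hF, fun x => ⟨_, ((CMc.const t ht.le).mul (CMc.green x x)).mul CMc.base,
      fun s hs => hF' s hs x⟩⟩
  | green y z =>
    exact ⟨fun s hs => diff_green A (hdet s hs) y z, fun x => ⟨_, (CMc.green y x).mul (CMc.green x z),
      fun s hs => fderiv_green A (hdet s hs) x y z⟩⟩
  | const c hc =>
    exact ⟨fun s hs => by fun_prop, fun x => ⟨_, CMc.const 0 le_rfl, fun s hs => by simp⟩⟩
  | add _ _ ih1 ih2 =>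
    refine ⟨fun s hs => (ih1.1 s hs).add (ih2.1 s hs), fun x => ?_⟩
    obtain ⟨g1, h1, h1'⟩ := ih1.2 x
    obtain ⟨g2, h2, h2'⟩ := ih2.2 x
    refine ⟨_, h1.add h2, fun s hs => ?_⟩
    rw [fderiv_fun_add (ih1.1 s hs) (ih2.1 s hs)]
    simp [h1' s hs, h2' s hs]; ring
  | @mul f g hf hg ih1 ih2 =>
    refine ⟨fun s hs => (ih1.1 s hs).mul (ih2.1 s hs), fun x => ?_⟩
    obtain ⟨g1, h1, h1'⟩ := ih1.2 x
    obtain ⟨g2, h2, h2'⟩ := ih2.2 x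
    refine ⟨_, (hf.mul h2).add (hg.mul h1), fun s hs => ?_⟩
    rw [fderiv_fun_mul (ih1.1 s hs) (ih2.1 s hs)]
    simp [h1' s hs, h2' s hs]; ring

lemma CMc_nonneg {A : Matrix X X ℝ} {F : (X → ℝ) → ℝ}  (s : X → ℝ)
    (hG : ∀ y z, 0 ≤ (A + Matrix.diagonal s)⁻¹ y z) (hF : 0 ≤ F s)
    {f : (X → ℝ) → ℝ} (hf : CMc A F f) : 0 ≤ f s := by
  induction hf with
  | base => exact hF
  | green y z => exact hG y z
  | const c hc => exact hc
  | add _ _ h1 h2 => exact add_nonneg h1 h2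
  | mul _ _ h1 h2 => exact mul_nonneg h1 h2

lemma CMc_iter {A : Matrix X X ℝ} {F : (X → ℝ) → ℝ}
    (hdet : ∀ s : X → ℝ, (∀ x, 0 < s x) → (A + Matrix.diagonal s).det ≠ 0)
    (hF : ∀ s : X → ℝ, (∀ x, 0 < s x) → DifferentiableAt ℝ F s)
    (t : ℝ) (ht : 0 < t)
    (hF' : ∀ s : X → ℝ, (∀ x, 0 < s x) → ∀ x, fderiv ℝ F s (Pi.single x 1) =
      -(t * (A + Matrix.diagonal s)⁻¹ x x * F s)) (l : List X) :
    ∃ g, CMc A F g ∧ ∀ s : X → ℝ, (∀ x, 0 < s x) →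
      iterPartial l F s = (-1) ^ l.length * g s := by
  induction l with
  | nil => exact ⟨F, CMc.base, fun s hs => by simp [iterPartial]⟩
  | cons x l ih =>
    obtain ⟨g, hg, hgl⟩ := ih
    obtain ⟨hd, hd'⟩ := CMc_main hdet hF t ht hF' hg
    obtain ⟨k, hk, hk'⟩ := hd' x
    refine ⟨k, hk, fun s hs => ?_⟩
    have he : iterPartial l F =ᶠ[nhds s] fun s => (-1) ^ l.length * g s := by
      filter_upwards [isOpen_posO.mem_nhds hs] with s' hs' using hgl s' hs'
    simp only [iterPartial]
    rw [he.fderiv_eq, fderiv_const_mul (hd s hs)]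
    simp [hk' s hs, pow_succ]

end helpers

/-- Let `L` be a real sub-generator matrix (nonnegative off-diagonal entries,
nonpositive row sums) which is invertible, and `Φ(s) = det(-L) / det(-L + M_s)`. Then `Φ > 0`
on `[0,∞)^X`, and for every real `t > 0` the fractional power `Φ^t` is completely monotone:
for every multi-index `α` (encoded as a list of coordinates with multiplicities) and every
`s ∈ (0,∞)^X`, `(-1)^{|α|} ∂^α (Φ^t)(s) ≥ 0`. (Infinite divisibility.) -/
theorem stmt6 {X : Type} [Fintype X] [Nonempty X] [DecidableEq X]
    (L : Matrix X X ℝ)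
    (hoff : ∀ x y, x ≠ y → 0 ≤ L x y)
    (hrow : ∀ x, ∑ y, L x y ≤ 0)
    (hinv : IsUnit L)
    (t : ℝ) (ht : 0 < t) :
    (∀ s : X → ℝ, (∀ x, 0 ≤ s x) →
      0 < (-L).det / (-L + Matrix.diagonal s).det) ∧
    (∀ (l : List X) (s : X → ℝ), (∀ x, 0 < s x) →
      0 ≤ (-1 : ℝ) ^ l.length *
        iterPartial l
          (fun s : X → ℝ => ((-L).det / (-L + Matrix.diagonal s).det) ^ t) s) := by
  have hoff' : ∀ x y, x ≠ y → (-L) x y ≤ 0 := fun x y h => by simpa using hoff x y h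
  have hrow' : ∀ x, 0 ≤ ∑ y, (-L) x y := fun x => by simpa using hrow x
  have hne : (-L).det ≠ 0 := by
    have : IsUnit (-L) := hinv.neg
    exact ((Matrix.isUnit_iff_isUnit_det _).mp this).ne_zero
  have hpos : 0 < (-L).det := lt_of_le_of_ne (zm_det_nonneg hoff' hrow') hne.symm
  have hposs : ∀ s : X → ℝ, (∀ x, 0 ≤ s x) → 0 < (-L + Matrix.diagonal s).det :=
    fun s hs => lt_of_lt_of_le hpos (zm_det_mono' hoff' hrow' s hs)
  have hd : ∀ s : X → ℝ, (∀ x, 0 < s x) → (-L + Matrix.diagonal s).det ≠ 0 :=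
    fun s hs => (hposs s fun x => (hs x).le).ne'
  refine ⟨fun s hs => div_pos hpos (hposs s hs), fun l s hs => ?_⟩
  have hphi : ∀ u : ℝ, 0 < u → HasDerivAt (fun u : ℝ => ((-L).det / u) ^ t)
      (-(t * ((-L).det / u) ^ t / u)) u := by
    intro u hu
    have hp := div_pos hpos hu
    have h1 : HasDerivAt (fun u : ℝ => (-L).det / u) (-((-L).det / u ^ 2)) u := by
      have := (hasDerivAt_inv hu.ne').const_mul (-L).det
      rw [mul_neg] at this
      simpa only [div_eq_mul_inv] using this
    convert h1.rpow_const (p := t) (Or.inl hp.ne') using 1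
    rw [Real.rpow_sub_one hp.ne']
    field_simp
  have hder := fun (s : X → ℝ) (hs : ∀ x, 0 < s x) =>
    (hphi _ (hposs s fun x => (hs x).le)).comp_hasFDerivAt s (diff_detA (-L) s).hasFDerivAt
  obtain ⟨g, hg, hgl⟩ := CMc_iter (A := -L)
    (F := fun s : X → ℝ => ((-L).det / (-L + Matrix.diagonal s).det) ^ t)
    hd (fun s hs => (hder s hs).differentiableAt) t ht
    (fun s hs x => by
      refine (congrArg (fun T => T (Pi.single x 1)) (hder s hs).fderiv).trans ?_
      simp only [ContinuousLinearMap.smul_apply, fderiv_det, zm_adj (hd s hs), smul_eq_mul]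
      have := hd s hs
      field_simp) l
  rw [hgl s hs, ← mul_assoc, ← mul_pow]
  simp only [mul_neg, mul_one, neg_neg, one_pow, one_mul]
  refine CMc_nonneg s (fun y z => ?_)
    (Real.rpow_nonneg (div_pos hpos (hposs s fun x => (hs x).le)).le t) hg
  refine zm_inv_nonneg (fun x y h => by simpa [h] using hoff x y h) (fun x => ?_) y z
  simp only [Matrix.add_apply, Finset.sum_add_distrib, Matrix.diagonal_apply,
    Finset.sum_ite_eq, Finset.mem_univ, if_true]
  linarith [hrow' x, hs x]
end

section
/- Let X be a finite nonempty set, m : X → (0,∞), and let L be a real X×X matrix with L_{xy} ≥ 0 for x ≠ y, Σ_{y∈X} L_{xy} ≤ 0 for all x, Σ_{x∈X} m_x L_{xy} ≤ 0 for all y, and such that Re⟨−Lz, z̄⟩_m ≥ ε⟨z, z̄⟩_m for some ε > 0 and all z ∈ ℂ^X. Then for every bounded measurable F : [0,∞)^X → [0,∞), the complex number (2π)^{−|X|} det(−M_m L) ∫_{ℂ^X} F((z_u \overline{z_u})_{u∈X}) exp((1/2)⟨Lz, z̄⟩_m) ∏_{u∈X} dx_u dy_u is a nonnegative real number, and for F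 ≡ 1 it equals 1. (Hence the twisted Gaussian density pushes forward to a probability measure Q on [0,∞)^X.) -/
open MeasureTheory Matrix ComplexConjugate

section aux
open scoped ComplexOrder

lemma char_int_nonneg {G : Type*} [Group G] [TopologicalSpace G] [IsTopologicalGroup G]
    [CompactSpace G] [MeasurableSpace G] [BorelSpace G] (μ : Measure G) [μ.IsMulLeftInvariant]
    (χ : G →* ℂ) : 0 ≤ ∫ g, χ g ∂μ := by
  by_cases h : ∀ g, χ g = 1
  · simp [h]
  · push Not at h
    obtain ⟨a, ha⟩ := h
    have h1 : ∫ g, χ (a * g) ∂μ = ∫ g, χ g ∂μ := integral_mul_left_eq_self (fun g => χ g) a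
    simp only [map_mul, integral_const_mul] at h1
    have h2 : (χ a - 1) * ∫ g, χ g ∂μ = 0 := by linear_combination h1
    rcases mul_eq_zero.1 h2 with h | h
    · exact absurd (sub_eq_zero.1 h) ha
    · rw [h]

lemma pow_int_nonneg {G : Type*} [Group G] [TopologicalSpace G] [IsTopologicalGroup G]
    [CompactSpace G] [MeasurableSpace G] [BorelSpace G] (μ : Measure G) [μ.IsMulLeftInvariant]
    [IsFiniteMeasure μ]
    {ι : Type*} [Fintype ι] (c : ι → ℝ) (hc : ∀ i, 0 ≤ c i) (χ : ι → G →* ℂ)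
    (hχ : ∀ i, Continuous (χ i)) (k : ℕ) : ∀ (ψ : G →* ℂ), Continuous ψ →
    0 ≤ ∫ g, (∑ i, (c i : ℂ) * χ i g) ^ k * ψ g ∂μ := by
  induction k with
  | zero => intro ψ _; simpa using char_int_nonneg μ ψ
  | succ k ih =>
    intro ψ hψ
    have h : ∀ g, (∑ i, (c i : ℂ) * χ i g) ^ (k+1) * ψ g =
        ∑ i, (c i : ℂ) * ((∑ i, (c i : ℂ) * χ i g) ^ k * (χ i * ψ) g) := by
      intro g
      rw [pow_succ, mul_assoc, Finset.sum_mul, Finset.mul_sum]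
      refine Finset.sum_congr rfl fun i _ => ?_
      simp only [MonoidHom.mul_apply]; ring
    simp_rw [h]
    rw [integral_finsetSum]
    · refine Finset.sum_nonneg fun i _ => ?_
      rw [integral_const_mul]
      exact mul_nonneg (by exact_mod_cast hc i) (ih (χ i * ψ) ((hχ i).mul hψ))
    · intro i _
      have : Continuous (χ i * ψ : G →* ℂ) := (hχ i).mul hψ
      refine Continuous.integrable_of_hasCompactSupport (by fun_prop) (HasCompactSupport.of_compactSpace _)

lemma exp_int_nonneg {G : Type*} [Group G] [TopologicalSpace G] [IsTopologicalGroup G]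
    [CompactSpace G] [MeasurableSpace G] [BorelSpace G] (μ : Measure G) [μ.IsMulLeftInvariant]
    [IsFiniteMeasure μ]
    {ι : Type*} [Fintype ι] (c : ι → ℝ) (hc : ∀ i, 0 ≤ c i) (χ : ι → G →* ℂ)
    (hχ : ∀ i, Continuous (χ i)) (hb : ∀ i g, ‖χ i g‖ ≤ 1) :
    0 ≤ ∫ g, Complex.exp (∑ i, (c i : ℂ) * χ i g) ∂μ := by
  have hcont : Continuous fun g => ∑ i, (c i : ℂ) * χ i g := by fun_prop
  have hi : ∀ k : ℕ, Integrable (fun g => (∑ i, (c i : ℂ) * χ i g) ^ k / (k.factorial : ℂ)) μ := by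
    intro k
    exact Continuous.integrable_of_hasCompactSupport (by fun_prop) (HasCompactSupport.of_compactSpace _)
  have hle : ∀ g, ‖∑ i, (c i : ℂ) * χ i g‖ ≤ ∑ i, c i := by
    intro g
    refine (norm_sum_le _ _).trans (Finset.sum_le_sum fun i _ => ?_)
    rw [norm_mul, Complex.norm_real, Real.norm_of_nonneg (hc i)]
    exact mul_le_of_le_one_right (hc i) (hb i g)
  have hs := hasSum_integral_of_summable_integral_norm hi (by
    refine Summable.of_nonneg_of_le (fun k => integral_nonneg fun g => norm_nonneg _)
      (fun k => ?_) ((Real.summable_pow_div_factorial (∑ i, c i)).mul_right (μ.real Set.univ))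
    calc ∫ g, ‖(∑ i, (c i : ℂ) * χ i g) ^ k / (k.factorial : ℂ)‖ ∂μ
        ≤ ∫ g, (∑ i, c i) ^ k / k.factorial ∂μ := by
          refine integral_mono (hi k).norm (integrable_const _) fun g => ?_
          simp only [norm_div, norm_pow, Complex.norm_natCast]
          gcongr
          exact hle g
      _ = _ := by simp [mul_comm])
  have he : ∀ g, ∑' k : ℕ, (∑ i, (c i : ℂ) * χ i g) ^ k / (k.factorial : ℂ)
      = Complex.exp (∑ i, (c i : ℂ) * χ i g) := by
    intro g
    rw [Complex.exp_eq_exp_ℂ, NormedSpace.exp_eq_tsum_div]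
  simp_rw [he] at hs
  refine hs.nonneg fun k => ?_
  rw [integral_div]
  have := pow_int_nonneg μ c hc χ hχ k 1 continuous_const
  simp only [MonoidHom.one_apply, mul_one] at this
  rw [div_eq_mul_inv]
  refine mul_nonneg this ?_
  rw [← Complex.ofReal_natCast, ← Complex.ofReal_inv]
  exact_mod_cast (by positivity)

open scoped MatrixOrder in
lemma diagonalize {X : Type*} [Fintype X] [DecidableEq X] (A : Matrix X X ℂ)
    (hA : ∀ z : X → ℂ, z ≠ 0 → 0 < (star z ⬝ᵥ A *ᵥ z).re) :
    ∃ (P : Matrix X X ℂ) (d : X → ℂ), IsUnit P.det ∧ Pᴴ * A * P = diagonal d := by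
  set H : Matrix X X ℂ := A + Aᴴ with hH
  have hHp : H.PosDef := by
    refine .of_dotProduct_mulVec_pos (by simp [H, Matrix.IsHermitian, add_comm]) fun z hz => ?_
    have h1 : star z ⬝ᵥ Aᴴ *ᵥ z = conj (star z ⬝ᵥ A *ᵥ z) := by
      rw [← Complex.star_def, Matrix.star_dotProduct, Matrix.star_mulVec,
        conjTranspose_conjTranspose, ← Matrix.dotProduct_mulVec]
    rw [hH, add_mulVec, dotProduct_add, h1, Complex.add_conj]
    exact_mod_cast mul_pos two_pos (hA z hz)
  obtain ⟨B, hBu, hB⟩ : ∃ B : Matrix X X ℂ, IsUnit B.det ∧ H = Bᴴ * B := by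
    obtain ⟨B, hB1, -, hB2⟩ := CFC.exists_sqrt_of_isSelfAdjoint_of_quasispectrumRestricts
      hHp.posSemidef.isHermitian (QuasispectrumRestricts.nnreal_of_nonneg hHp.posSemidef.nonneg)
    have hd := hHp.det_pos.ne'
    rw [← hB2, det_mul] at hd
    refine ⟨B, isUnit_iff_ne_zero.2 (left_ne_zero_of_mul hd), ?_⟩
    have : Bᴴ = B := hB1.star_eq
    rw [this, hB2]
  set K : Matrix X X ℂ := Complex.I • (A - Aᴴ) with hK
  have hKh : K.IsHermitian := by
    simp [K, Matrix.IsHermitian, conjTranspose_smul]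
    rw [← smul_neg]; simp
  have hK' : ((B⁻¹)ᴴ * K * B⁻¹).IsHermitian := isHermitian_conjTranspose_mul_mul _ hKh
  have hs := hK'.spectral_theorem
  set U : Matrix X X ℂ := (hK'.eigenvectorUnitary : Matrix X X ℂ) with hU
  have hUU : Uᴴ * U = 1 := by
    have := Unitary.coe_star_mul_self hK'.eigenvectorUnitary
    exact this
  set D : Matrix X X ℂ := diagonal (RCLike.ofReal ∘ hK'.eigenvalues)
  have hs2 : (B⁻¹)ᴴ * K * B⁻¹ = U * D * Uᴴ := by
    rw [hs]; rfl
  have hAe : A = (1/2 : ℂ) • H - (Complex.I / 2) • K := by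
    rw [hH, hK, smul_smul, smul_add, smul_sub]
    have : Complex.I / 2 * Complex.I = -(1/2) := by
      rw [div_mul_eq_mul_div, Complex.I_mul_I]; ring
    rw [this]; module
  refine ⟨B⁻¹ * U, fun i => 1/2 - Complex.I / 2 * (hK'.eigenvalues i : ℂ), ?_, ?_⟩
  · rw [det_mul]
    refine IsUnit.mul ?_ ?_
    · exact (Matrix.isUnit_nonsing_inv_det_iff).2 hBu
    · have := congrArg det hUU
      rw [det_mul, det_one] at this
      exact IsUnit.of_mul_eq_one_right _ this
  · have e1 : (B⁻¹ * U)ᴴ * H * (B⁻¹ * U) = 1 := by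
      have : B * B⁻¹ = 1 := Matrix.mul_nonsing_inv _ hBu
      have : (B * B⁻¹)ᴴ * (B * B⁻¹) = 1 := by simp [this]
      calc (B⁻¹ * U)ᴴ * H * (B⁻¹ * U) = Uᴴ * ((B * B⁻¹)ᴴ * (B * B⁻¹)) * U := by
            rw [hB]; simp only [conjTranspose_mul, Matrix.mul_assoc]
        _ = 1 := by rw [this, Matrix.mul_one, hUU]
    have e2 : (B⁻¹ * U)ᴴ * K * (B⁻¹ * U) = D := by
      calc (B⁻¹ * U)ᴴ * K * (B⁻¹ * U) = Uᴴ * ((B⁻¹)ᴴ * K * B⁻¹) * U := by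
            simp only [conjTranspose_mul, Matrix.mul_assoc]
        _ = (Uᴴ * U) * D * (Uᴴ * U) := by rw [hs2]; simp only [Matrix.mul_assoc]
        _ = D := by simp [hUU]
    calc (B⁻¹ * U)ᴴ * A * (B⁻¹ * U) = (1/2 : ℂ) • ((B⁻¹ * U)ᴴ * H * (B⁻¹ * U))
            - (Complex.I / 2) • ((B⁻¹ * U)ᴴ * K * (B⁻¹ * U)) := by
          rw [hAe, Matrix.mul_sub, Matrix.sub_mul]; simp
      _ = _ := by
          rw [e1, e2]
          ext i j
          by_cases h : i = j
          · subst h; simp [D]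
          · simp [D, h]

lemma gauss_one (b : ℂ) (hb : 0 < b.re) :
    ∫ w : ℂ, Complex.exp (-(1/2) * (b * (Complex.normSq w : ℂ))) = 2 * Real.pi / b := by
  have h := GaussianFourier.integral_cexp_neg_mul_sq_norm (b := b/2) (V := ℂ) (by
    simpa using hb)
  have : b ≠ 0 := by rintro rfl; simp at hb
  simp only [Complex.finrank_real_complex, Nat.cast_ofNat] at h
  rw [div_self two_ne_zero, Complex.cpow_one] at h
  rw [show 2 * (Real.pi : ℂ) / b = Real.pi / (b/2) by field_simp, ← h]
  congr 1; ext w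
  rw [Complex.normSq_eq_norm_sq]
  congr 1; push_cast; ring

lemma gauss {X : Type*} [Fintype X] [DecidableEq X] (A : Matrix X X ℂ)
    (hA : ∀ z : X → ℂ, z ≠ 0 → 0 < (star z ⬝ᵥ A *ᵥ z).re) :
    A.det * ∫ z : X → ℂ, Complex.exp (-(1/2) * (star z ⬝ᵥ A *ᵥ z)) =
      (2 * Real.pi) ^ Fintype.card X := by
  obtain ⟨P, d, hP, hd⟩ := diagonalize A hA
  have hform : ∀ w : X → ℂ, star (P *ᵥ w) ⬝ᵥ A *ᵥ (P *ᵥ w) =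
      ∑ i, d i * (Complex.normSq (w i) : ℂ) := by
    intro w
    have : star (P *ᵥ w) ⬝ᵥ A *ᵥ (P *ᵥ w) = star w ⬝ᵥ (Pᴴ * A * P) *ᵥ w := by
      rw [Matrix.star_mulVec, ← Matrix.dotProduct_mulVec, Matrix.mulVec_mulVec,
        Matrix.mulVec_mulVec, Matrix.mul_assoc]
    rw [this, hd]
    simp only [dotProduct, mulVec_diagonal, Pi.star_apply, Complex.star_def]
    refine Finset.sum_congr rfl fun i _ => ?_
    rw [Complex.normSq_eq_conj_mul_self]; ring
  have hdpos : ∀ i, 0 < (d i).re := by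
    intro i
    have h0 : P *ᵥ (Pi.single i 1) ≠ 0 := by
      intro h
      have := congrArg (fun v => P⁻¹ *ᵥ v) h
      simp only [Matrix.mulVec_mulVec, Matrix.nonsing_inv_mul _ hP, Matrix.one_mulVec,
        Matrix.mulVec_zero] at this
      have := congrFun this i
      simp at this
    have := hA _ h0
    rw [hform, Finset.sum_eq_single i] at this
    · simpa using this
    · intro j _ hj; simp [hj]
    · simp
  let f : (X → ℂ) →ₗ[ℝ] (X → ℂ) := (Matrix.toLin' P).restrictScalars ℝ
  have hf : ∀ w, f w = P *ᵥ w := fun w => by simp [f]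
  have hfdet : LinearMap.det f = Complex.normSq P.det := by
    rw [LinearMap.det_restrictScalars, Algebra.norm_complex_eq]; simp
  have hfne : LinearMap.det f ≠ 0 := by
    rw [hfdet]; simpa using hP.ne_zero
  have hmap := Measure.map_linearMap_addHaar_eq_smul_addHaar (volume : Measure (X → ℂ)) hfne
  have hcv : ∫ w : X → ℂ, Complex.exp (-(1/2) * (star (f w) ⬝ᵥ A *ᵥ (f w))) =
      (Complex.normSq P.det : ℂ)⁻¹ * ∫ z : X → ℂ, Complex.exp (-(1/2) * (star z ⬝ᵥ A *ᵥ z)) := by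
    have hc : Continuous fun z : X → ℂ => Complex.exp (-(1/2) * (star z ⬝ᵥ A *ᵥ z)) := by
      simp only [dotProduct, mulVec, Pi.star_apply]
      fun_prop
    rw [← integral_map (φ := f) (f := fun z : X → ℂ => Complex.exp (-(1/2) * (star z ⬝ᵥ A *ᵥ z)))
      (f.continuous_of_finiteDimensional.aemeasurable) hc.aestronglyMeasurable, hmap,
      integral_smul_measure, ENNReal.toReal_ofReal (abs_nonneg _), hfdet,
      abs_of_nonneg (inv_nonneg.2 (Complex.normSq_nonneg _)), Complex.real_smul]
    push_cast; rfl
  have hI : ∫ w : X → ℂ, Complex.exp (-(1/2) * (star (f w) ⬝ᵥ A *ᵥ (f w))) =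
      ∏ i, (2 * Real.pi / d i) := by
    simp_rw [hf, hform, Finset.mul_sum, Complex.exp_sum]
    rw [integral_fintype_prod_volume_eq_prod
      (fun i (w : ℂ) => Complex.exp (-(1/2) * (d i * (Complex.normSq w : ℂ))))]
    exact Finset.prod_congr rfl fun i _ => gauss_one _ (hdpos i)
  have hdet : (Complex.normSq P.det : ℂ) * A.det = ∏ i, d i := by
    have := congrArg det hd
    rw [det_mul, det_mul, det_conjTranspose, det_diagonal] at this
    rw [← this, Complex.normSq_eq_conj_mul_self, Complex.star_def]; ring
  have hne : (Complex.normSq P.det : ℂ) ≠ 0 := by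
    rw [← hfdet]; exact_mod_cast hfne
  have hdne : ∏ i, d i ≠ 0 := Finset.prod_ne_zero_iff.2 fun i _ h => by
    have := hdpos i; rw [h] at this; simp at this
  rw [hI, Finset.prod_div_distrib, Finset.prod_const, Finset.card_univ] at hcv
  have h3 : ∫ z : X → ℂ, Complex.exp (-(1/2) * (star z ⬝ᵥ A *ᵥ z)) =
    (Complex.normSq P.det : ℂ) * ((2 * Real.pi) ^ Fintype.card X / ∏ i, d i) := by
    rw [hcv]; field_simp
  rw [h3, ← hdet]
  rw [← hdet] at hdne
  have := right_ne_zero_of_mul hdne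
  field_simp

/-- the twisted quadratic form -/
noncomputable def Qf {X : Type} [Fintype X] (m : X → ℝ) (L : Matrix X X ℝ) (z : X → ℂ) : ℂ :=
  ∑ x, (L.map Complex.ofReal *ᵥ z) x * conj (z x) * (m x : ℂ)

lemma Qf_cont {X : Type} [Fintype X] (m : X → ℝ) (L : Matrix X X ℝ) : Continuous (Qf m L) := by
  unfold Qf
  simp only [mulVec, dotProduct]
  fun_prop

/-- characters of the torus -/
noncomputable def chr {X : Type} (p : X × X) : (X → Circle) →* ℂ where
  toFun θ := (θ p.2 : ℂ) * conj (θ p.1 : ℂ)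
  map_one' := by simp
  map_mul' a b := by simp; ring

lemma torus_nonneg_real {X : Type} [Fintype X] [DecidableEq X]
    [MeasurableSpace (X → Circle)] [BorelSpace (X → Circle)]
    (μ : Measure (X → Circle)) [μ.IsMulLeftInvariant] [IsFiniteMeasure μ]
    (m : X → ℝ) (hm : ∀ x, 0 < m x) (L : Matrix X X ℝ)
    (hoff : ∀ x y, x ≠ y → 0 ≤ L x y) (r : X → ℝ) (hr : ∀ x, 0 ≤ r x) :
    0 ≤ ∫ θ : X → Circle, Complex.exp ((1/2) * Qf m L (fun x => (θ x : ℂ) * (r x : ℂ))) ∂μ := by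
  let c : X × X → ℝ := fun p => if p.1 = p.2 then 0 else 1/2 * m p.1 * L p.1 p.2 * r p.1 * r p.2
  let d : ℝ := ∑ x, 1/2 * m x * L x x * r x * r x
  have hc : ∀ p, 0 ≤ c p := by
    intro p
    simp only [c]
    split_ifs with h
    · exact le_rfl
    · have := hoff _ _ h
      have := hm p.1
      have := hr p.1
      have := hr p.2
      positivity
  have hQ : ∀ θ : X → Circle, (1/2) * Qf m L (fun x => (θ x : ℂ) * (r x : ℂ)) =
      (d : ℂ) + ∑ p, (c p : ℂ) * chr p θ := by
    intro θ
    have hd : (d : ℂ) = ∑ p : X × X, if p.1 = p.2 then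
        (1/2 * m p.1 * L p.1 p.2 * r p.1 * r p.2 : ℂ) * chr p θ else 0 := by
      rw [Fintype.sum_prod_type]
      simp only [Finset.sum_ite_eq, Finset.mem_univ, if_true, d]
      push_cast
      refine Finset.sum_congr rfl fun x _ => ?_
      have : chr (x, x) θ = 1 := by
        change (θ x : ℂ) * conj (θ x : ℂ) = 1
        rw [Complex.mul_conj]; simp
      rw [this, mul_one]
    rw [hd, ← Finset.sum_add_distrib]
    simp only [Qf, mulVec, dotProduct, Finset.sum_mul, Finset.mul_sum]
    rw [← Fintype.sum_prod_type']
    refine Finset.sum_congr rfl fun p _ => ?_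
    simp only [c]
    change _ = _ + _ * ((θ p.2 : ℂ) * conj (θ p.1 : ℂ))
    split_ifs with h
    · rw [show chr p θ = (θ p.2 : ℂ) * conj (θ p.1 : ℂ) from rfl]
      simp; ring
    · simp; ring
  simp_rw [hQ, Complex.exp_add]
  rw [integral_const_mul]
  refine mul_nonneg ?_ (exp_int_nonneg μ c hc chr ?_ ?_)
  · rw [← Complex.ofReal_exp]; exact_mod_cast (Real.exp_pos d).le
  · intro p
    change Continuous fun θ : X → Circle => (θ p.2 : ℂ) * conj (θ p.1 : ℂ)
    fun_prop
  · intro p θ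
    change ‖(θ p.2 : ℂ) * conj (θ p.1 : ℂ)‖ ≤ 1
    rw [norm_mul, RCLike.norm_conj, Circle.norm_coe, Circle.norm_coe, one_mul]

lemma torus_nonneg {X : Type} [Fintype X] [DecidableEq X]
    [MeasurableSpace (X → Circle)] [BorelSpace (X → Circle)]
    (μ : Measure (X → Circle)) [μ.IsMulLeftInvariant] [IsFiniteMeasure μ]
    (m : X → ℝ) (hm : ∀ x, 0 < m x) (L : Matrix X X ℝ)
    (hoff : ∀ x y, x ≠ y → 0 ≤ L x y) (z : X → ℂ) :
    0 ≤ ∫ θ : X → Circle, Complex.exp ((1/2) * Qf m L (fun x => (θ x : ℂ) * z x)) ∂μ := by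
  let a : X → Circle := fun x => Circle.exp (z x).arg
  have h := torus_nonneg_real μ m hm L hoff (fun x => ‖z x‖) (fun x => norm_nonneg _)
  rw [← integral_mul_left_eq_self _ a] at h
  convert h using 5 with θ
  congr 1
  ext x
  simp only [Pi.mul_apply, Circle.coe_mul, a, Circle.coe_exp]
  conv_lhs => rw [← Complex.norm_mul_exp_arg_mul_I (z x)]
  ring

lemma gauss_integrable {X : Type} [Fintype X] (m : X → ℝ) (hm : ∀ x, 0 < m x)
    (ε : ℝ) (hε : 0 < ε) :
    Integrable (fun z : X → ℂ => Real.exp (-(1/2) * (ε * ∑ x, Complex.normSq (z x) * m x))) := by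
  have h : ∀ z : X → ℂ, Real.exp (-(1/2) * (ε * ∑ x, Complex.normSq (z x) * m x)) =
      ∏ x, Real.exp (-(1/2 * ε * m x) * ‖z x‖ ^ 2) := by
    intro z
    rw [← Real.exp_sum, Finset.mul_sum, Finset.mul_sum]
    congr 1
    refine Finset.sum_congr rfl fun x _ => ?_
    rw [Complex.normSq_eq_norm_sq]; ring
  simp_rw [h]
  refine Integrable.fintype_prod (f := fun x (w : ℂ) => Real.exp (-(1/2 * ε * m x) * ‖w‖ ^ 2))
    fun x => ?_
  have hp : 0 < 1/2 * ε * m x := by have := hm x; positivity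
  have := GaussianFourier.integrable_cexp_neg_mul_sq_norm_add (V := ℂ) (b := ((1/2 * ε * m x : ℝ) : ℂ))
    (by simpa using hp) 0 0
  convert this.norm using 2 with w
  rw [Complex.norm_exp]
  congr 1
  rw [← Complex.ofReal_neg, ← Complex.ofReal_pow]
  simp [-Complex.ofReal_mul, -Complex.ofReal_neg, -Complex.ofReal_pow, ← Complex.ofReal_mul]

lemma main_nonneg {X : Type} [Fintype X] [DecidableEq X]
    (m : X → ℝ) (hm : ∀ x, 0 < m x) (L : Matrix X X ℝ)
    (hoff : ∀ x y, x ≠ y → 0 ≤ L x y)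
    (ε : ℝ) (hε : 0 < ε)
    (hL : ∀ z : X → ℂ, ε * ∑ x, Complex.normSq (z x) * m x ≤ (-Qf m L z).re)
    (F : (X → ℝ) → ℝ) (hFmeas : Measurable F) (hF0 : ∀ ρ, 0 ≤ F ρ)
    (hFbdd : ∃ Cb : ℝ, ∀ ρ, F ρ ≤ Cb) :
    0 ≤ ∫ z : X → ℂ, (F (fun u => Complex.normSq (z u)) : ℂ) *
          Complex.exp ((1/2) * Qf m L z) := by
  let _ : MeasurableSpace (X → Circle) := borel _
  have : BorelSpace (X → Circle) := ⟨rfl⟩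
  let μ : Measure (X → Circle) := Measure.haar
  obtain ⟨C, hC⟩ := hFbdd
  let f : (X → ℂ) → (X → Circle) → ℂ := fun z θ =>
    (F (fun u => Complex.normSq (z u)) : ℂ) * Complex.exp ((1/2) * Qf m L (fun x => (θ x : ℂ) * z x))
  have hint : Integrable (Function.uncurry f) (volume.prod μ) := by
    refine Integrable.mono' (((gauss_integrable m hm ε hε).const_mul C).comp_fst μ) ?_ ?_
    · have h1 : Measurable fun p : (X → ℂ) × (X → Circle) =>
          (F (fun u => Complex.normSq (p.1 u)) : ℂ) := by
        refine Complex.measurable_ofReal.comp (hFmeas.comp ?_)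
        refine measurable_pi_lambda _ fun u => ?_
        exact Complex.continuous_normSq.measurable.comp ((measurable_pi_apply u).comp measurable_fst)
      have h2 : Continuous fun p : (X → ℂ) × (X → Circle) =>
          Complex.exp ((1/2) * Qf m L (fun x => (p.2 x : ℂ) * p.1 x)) := by
        have := Qf_cont m L
        fun_prop
      exact (h1.mul h2.measurable).aestronglyMeasurable
    · refine Filter.Eventually.of_forall fun p => ?_
      simp only [Function.uncurry, f, norm_mul, Complex.norm_real, Real.norm_of_nonneg (hF0 _)]
      refine mul_le_mul (hC _) ?_ (norm_nonneg _) ((hF0 _).trans (hC 0))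
      rw [Complex.norm_exp, Real.exp_le_exp]
      have := hL (fun x => (p.2 x : ℂ) * p.1 x)
      simp only [Complex.normSq_mul, Circle.normSq_coe, one_mul, Complex.neg_re] at this
      have e : ((1/2 : ℂ) * Qf m L (fun x => (p.2 x : ℂ) * p.1 x)).re =
          1/2 * (Qf m L (fun x => (p.2 x : ℂ) * p.1 x)).re := by
        rw [show (1/2 : ℂ) = ((1/2 : ℝ) : ℂ) by norm_num, Complex.re_ofReal_mul]
      rw [e]; linarith
  have hsw := integral_integral_swap hint
  have hr : ∀ θ, ∫ z, f z θ = ∫ z : X → ℂ, (F (fun u => Complex.normSq (z u)) : ℂ) *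
          Complex.exp ((1/2) * Qf m L z) := by
    intro θ
    have hp : MeasurePreserving (fun (z : X → ℂ) (x : X) => rotation (θ x) (z x)) :=
      volume_preserving_pi fun x => (rotation (θ x)).measurePreserving
    have hmeas : Measurable fun z : X → ℂ => (F (fun u => Complex.normSq (z u)) : ℂ) *
          Complex.exp ((1/2) * Qf m L z) := by
      have h2 : Continuous fun z : X → ℂ => Complex.exp ((1/2) * Qf m L z) := by
        have := Qf_cont m L
        fun_prop
      refine Measurable.mul (Complex.measurable_ofReal.comp (hFmeas.comp ?_)) h2.measurable
      refine measurable_pi_lambda _ fun u => ?_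
      exact Complex.continuous_normSq.measurable.comp (measurable_pi_apply u)
    rw [← hp.map_eq, integral_map hp.measurable.aemeasurable hmeas.aestronglyMeasurable, hp.map_eq]
    simp [f]
  simp_rw [hr] at hsw
  rw [integral_const, Complex.real_smul] at hsw
  have h0 : 0 ≤ ∫ z, ∫ θ, f z θ ∂μ := by
    refine integral_nonneg fun z => ?_
    simp only [f, integral_const_mul]
    exact mul_nonneg (by exact_mod_cast hF0 _) (torus_nonneg μ m hm L hoff z)
  have hpos : 0 < μ.real Set.univ := by
    rw [measureReal_def]
    exact ENNReal.toReal_pos (NeZero.ne _) (measure_ne_top _ _)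
  rw [hsw] at h0
  have := mul_nonneg (a := ((μ.real Set.univ)⁻¹ : ℂ)) (by
    rw [← Complex.ofReal_inv]; exact_mod_cast (inv_pos.2 hpos).le) h0
  rwa [← mul_assoc, inv_mul_cancel₀ (by exact_mod_cast hpos.ne'), one_mul] at this

end aux

open scoped ComplexOrder in
/-- Let `L` be a sub-generator on the finite set `X` (nonnegative
off-diagonal entries, nonpositive row sums, nonpositive `m`-weighted column sums) with a mass
gap. Then for every bounded measurable `F : [0,∞)^X → [0,∞)` the normalized twisted Gaussian
functional `(2π)^{-|X|} det(-M_m L) ∫ F((z_u z̄_u)_u) exp((1/2)⟨L z, z̄⟩_m)` is a nonnegative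
real number, and it equals `1` when `F ≡ 1` (so the twisted density defines a probability
measure `Q` on `[0,∞)^X`). -/
theorem stmt7 {X : Type} [Fintype X] [Nonempty X] [DecidableEq X]
    (m : X → ℝ) (hm : ∀ x, 0 < m x) (L : Matrix X X ℝ)
    (hoff : ∀ x y, x ≠ y → 0 ≤ L x y)
    (hrow : ∀ x, ∑ y, L x y ≤ 0)
    (hcol : ∀ y, ∑ x, m x * L x y ≤ 0)
    (ε : ℝ) (hε : 0 < ε)
    (hL : ∀ z : X → ℂ,
      ε * ∑ x, Complex.normSq (z x) * m x ≤
        (∑ x, (-(L.map Complex.ofReal *ᵥ z) x) * conj (z x) * (m x : ℂ)).re)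
    (F : (X → ℝ) → ℝ) (hFmeas : Measurable F) (hF0 : ∀ ρ, 0 ≤ F ρ)
    (hFbdd : ∃ Cb : ℝ, ∀ ρ, F ρ ≤ Cb) :
    ((((2 * Real.pi) ^ (Fintype.card X) : ℝ) : ℂ)⁻¹ *
        (((-(Matrix.diagonal m * L)).det : ℝ) : ℂ) *
        ∫ z : X → ℂ, (F (fun u => Complex.normSq (z u)) : ℂ) *
          Complex.exp ((1/2) * ∑ x,
            (L.map Complex.ofReal *ᵥ z) x * conj (z x) * (m x : ℂ))).im = 0 ∧
    0 ≤ ((((2 * Real.pi) ^ (Fintype.card X) : ℝ) : ℂ)⁻¹ *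
        (((-(Matrix.diagonal m * L)).det : ℝ) : ℂ) *
        ∫ z : X → ℂ, (F (fun u => Complex.normSq (z u)) : ℂ) *
          Complex.exp ((1/2) * ∑ x,
            (L.map Complex.ofReal *ᵥ z) x * conj (z x) * (m x : ℂ))).re ∧
    (((2 * Real.pi) ^ (Fintype.card X) : ℝ) : ℂ)⁻¹ *
        (((-(Matrix.diagonal m * L)).det : ℝ) : ℂ) *
        ∫ z : X → ℂ,
          Complex.exp ((1/2) * ∑ x,
            (L.map Complex.ofReal *ᵥ z) x * conj (z x) * (m x : ℂ)) = 1 := by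
  have hL' : ∀ z : X → ℂ, ε * ∑ x, Complex.normSq (z x) * m x ≤ (-Qf m L z).re := by
    intro z
    refine (hL z).trans_eq ?_
    simp only [Qf, ← Finset.sum_neg_distrib, neg_mul]
  have hI := main_nonneg m hm L hoff ε hε hL' F hFmeas hF0 hFbdd
  have hI1 := main_nonneg m hm L hoff ε hε hL' (fun _ => 1) measurable_const
    (fun _ => zero_le_one) ⟨1, fun _ => le_rfl⟩
  simp only [Complex.ofReal_one, one_mul] at hI1
  set A : Matrix X X ℂ := (-(Matrix.diagonal m * L)).map Complex.ofReal with hAdef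
  have hdet : A.det = (((-(Matrix.diagonal m * L)).det : ℝ) : ℂ) := by
    exact (RingHom.map_det Complex.ofRealHom _).symm
  have hform : ∀ z : X → ℂ, star z ⬝ᵥ A *ᵥ z = -Qf m L z := by
    intro z
    simp only [Qf, ← Finset.sum_neg_distrib, dotProduct, mulVec, A, Finset.sum_mul, Finset.mul_sum]
    refine Finset.sum_congr rfl fun x _ => Finset.sum_congr rfl fun y _ => ?_
    simp
    ring
  have hg := gauss A (by
    intro z hz
    rw [hform]
    refine lt_of_lt_of_le ?_ (hL' z)
    obtain ⟨x, hx⟩ := Function.ne_iff.1 hz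
    refine mul_pos hε (Finset.sum_pos' (fun y _ => mul_nonneg (Complex.normSq_nonneg _) (hm y).le)
      ⟨x, Finset.mem_univ _, mul_pos (Complex.normSq_pos.2 hx) (hm x)⟩))
  rw [hdet] at hg
  simp only [hform, neg_mul_neg] at hg
  change ((((2 * Real.pi) ^ (Fintype.card X) : ℝ) : ℂ)⁻¹ *
        (((-(Matrix.diagonal m * L)).det : ℝ) : ℂ) *
        ∫ z : X → ℂ, (F (fun u => Complex.normSq (z u)) : ℂ) *
          Complex.exp ((1/2) * Qf m L z)).im = 0 ∧
    0 ≤ ((((2 * Real.pi) ^ (Fintype.card X) : ℝ) : ℂ)⁻¹ *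
        (((-(Matrix.diagonal m * L)).det : ℝ) : ℂ) *
        ∫ z : X → ℂ, (F (fun u => Complex.normSq (z u)) : ℂ) *
          Complex.exp ((1/2) * Qf m L z)).re ∧
    (((2 * Real.pi) ^ (Fintype.card X) : ℝ) : ℂ)⁻¹ *
        (((-(Matrix.diagonal m * L)).det : ℝ) : ℂ) *
        ∫ z : X → ℂ, Complex.exp ((1/2) * Qf m L z) = 1
  set D : ℝ := (-(Matrix.diagonal m * L)).det
  have hpi : 0 < (2 * Real.pi) ^ (Fintype.card X) := by positivity
  have hpic : (2 * (Real.pi : ℂ)) ^ (Fintype.card X) = (((2 * Real.pi) ^ (Fintype.card X) : ℝ) : ℂ) := by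
    push_cast; rfl
  rw [hpic] at hg
  have hD : 0 ≤ D := by
    by_contra hneg
    push Not at hneg
    have h1 := congrArg Complex.re hg
    rw [Complex.re_ofReal_mul, Complex.ofReal_re] at h1
    have h2 := mul_nonpos_of_nonpos_of_nonneg hneg.le (Complex.le_def.1 hI1).1
    linarith
  have hfin : 0 ≤ (((2 * Real.pi) ^ (Fintype.card X) : ℝ) : ℂ)⁻¹ * (D : ℂ) *
        ∫ z : X → ℂ, (F (fun u => Complex.normSq (z u)) : ℂ) *
          Complex.exp ((1/2) * Qf m L z) := by
    refine mul_nonneg ?_ hI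
    rw [← Complex.ofReal_inv, ← Complex.ofReal_mul]
    exact_mod_cast mul_nonneg (inv_pos.2 hpi).le hD
  refine ⟨(Complex.le_def.1 hfin).2.symm, (Complex.le_def.1 hfin).1, ?_⟩
  rw [mul_assoc, hg]
  exact inv_mul_cancel₀ (by exact_mod_cast hpi.ne')
end

section
/- Let X be a finite nonempty set, m : X → (0,∞), and let L be a real X×X matrix with L_{xy} ≥ 0 for x ≠ y, Σ_{y∈X} L_{xy} ≤ 0 for all x, Σ_{x∈X} m_x L_{xy} ≤ 0 for all y, and such that Re⟨−Lz, z̄⟩_m ≥ ε⟨z, z̄⟩_m for some ε > 0 and all z ∈ ℂ^X. Then for every ρ ∈ [0,∞)^X, the angular integral ∫_{[0,2π]^X} exp((1/2)⟨L w(θ), \overline{w(θ)}⟩_m) ∏_{u∈X} dθ_u, where w(θ)_u = √(ρ_u) e^{iθ_u}, is a nonnegative real number. (This is the positivity of the density of the twisted squared Gaussian field, which is not a priori obvious when L is not m-symmetric.) -/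
open MeasureTheory Matrix ComplexConjugate
open scoped ComplexOrder

noncomputable def chi8 {X : Type} [Fintype X] (k : X → ℤ) (θ : X → ℝ) : ℂ :=
  ∏ u, Complex.exp (Complex.I * (k u : ℂ) * (θ u : ℂ))

theorem chi8_cont {X : Type} [Fintype X] (k : X → ℤ) : Continuous (chi8 k) := by
  unfold chi8
  fun_prop

theorem chi8_mul {X : Type} [Fintype X] (k l : X → ℤ) (θ : X → ℝ) :
    chi8 k θ * chi8 l θ = chi8 (k + l) θ := by
  unfold chi8
  rw [← Finset.prod_mul_distrib]
  refine Finset.prod_congr rfl fun u _ => ?_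
  rw [← Complex.exp_add]
  congr 1
  simp only [Pi.add_apply]
  push_cast
  ring

theorem chi8_zero {X : Type} [Fintype X] (θ : X → ℝ) : chi8 0 θ = 1 := by
  simp [chi8]

theorem chi8_norm {X : Type} [Fintype X] (k : X → ℤ) (θ : X → ℝ) : ‖chi8 k θ‖ = 1 := by
  unfold chi8
  rw [norm_prod]
  refine Finset.prod_eq_one fun u _ => ?_
  rw [Complex.norm_exp]
  simp

theorem one8 (k : ℤ) : 0 ≤ ∫ t in Set.Icc (0 : ℝ) (2 * Real.pi),
    Complex.exp (Complex.I * (k : ℂ) * (t : ℂ)) := by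
  rw [integral_Icc_eq_integral_Ioc, ← intervalIntegral.integral_of_le (by positivity)]
  by_cases hk : k = 0
  · subst hk
    simp only [Int.cast_zero, mul_zero, zero_mul, Complex.exp_zero]
    simp
    have h : (0 : ℂ) ≤ ((2 * Real.pi : ℝ) : ℂ) := Complex.zero_le_real.2 (by positivity)
    simpa using h
  · rw [integral_exp_mul_complex (by simp [hk])]
    have : Complex.exp (Complex.I * (k : ℂ) * ((2 * Real.pi : ℝ) : ℂ)) = 1 := by
      rw [Complex.exp_eq_one_iff]
      exact ⟨k, by push_cast; ring⟩
    rw [this]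
    simp

abbrev box8 (X : Type) : Set (X → ℝ) := Set.univ.pi fun _ : X => Set.Icc (0 : ℝ) (2 * Real.pi)

theorem box8_compact (X : Type) : IsCompact (box8 X) :=
  isCompact_univ_pi fun _ => isCompact_Icc

theorem chi8_int {X : Type} [Fintype X] (k : X → ℤ) :
    0 ≤ ∫ θ in box8 X, chi8 k θ := by
  unfold chi8 box8
  rw [volume_pi, Measure.restrict_pi_pi]
  rw [integral_fintype_prod_eq_prod (𝕜 := ℂ)
    (f := fun u (t : ℝ) => Complex.exp (Complex.I * (k u : ℂ) * (t : ℂ)))]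
  exact Finset.prod_nonneg fun u _ => one8 (k u)

theorem pow8 {X ι : Type} [Fintype X] [Fintype ι] (b : ι → ℝ) (hb : ∀ i, 0 ≤ b i)
    (l : ι → X → ℤ) (n : ℕ) : ∀ k : X → ℤ,
    0 ≤ ∫ θ in box8 X, (∑ i, (b i : ℂ) * chi8 (l i) θ) ^ n * chi8 k θ := by
  induction n with
  | zero => intro k; simpa using chi8_int k
  | succ n ih =>
    intro k
    have h : ∀ θ : X → ℝ, (∑ i, (b i : ℂ) * chi8 (l i) θ) ^ (n+1) * chi8 k θ
        = ∑ j, (b j : ℂ) * ((∑ i, (b i : ℂ) * chi8 (l i) θ) ^ n * chi8 (l j + k) θ) := by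
      intro θ
      rw [pow_succ, mul_assoc, Finset.sum_mul, Finset.mul_sum]
      refine Finset.sum_congr rfl fun j _ => ?_
      rw [← chi8_mul]
      ring
    simp_rw [h]
    rw [integral_finsetSum]
    · refine Finset.sum_nonneg fun j _ => ?_
      rw [integral_const_mul]
      exact mul_nonneg (by exact_mod_cast hb j) (ih _)
    · intro j _
      refine ContinuousOn.integrableOn_compact (box8_compact X) (Continuous.continuousOn ?_)
      have := fun k : X → ℤ => chi8_cont k
      fun_prop

theorem exp8 {X ι : Type} [Fintype X] [Fintype ι] (b : ι → ℝ) (hb : ∀ i, 0 ≤ b i)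
    (l : ι → X → ℤ) :
    0 ≤ ∫ θ in box8 X, Complex.exp (∑ i, (b i : ℂ) * chi8 (l i) θ) := by
  have hfin : volume (box8 X) < ⊤ := (box8_compact X).measure_lt_top
  have hc := fun k : X → ℤ => chi8_cont k
  have key := hasSum_integral_of_dominated_convergence (μ := volume.restrict (box8 X))
    (F := fun (n : ℕ) (θ : X → ℝ) => (∑ i, (b i : ℂ) * chi8 (l i) θ) ^ n / (n.factorial : ℂ))
    (f := fun θ => Complex.exp (∑ i, (b i : ℂ) * chi8 (l i) θ))
    (fun n _ => (∑ i, b i) ^ n / (n.factorial : ℝ))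
    (fun n => by
      refine Continuous.aestronglyMeasurable ?_
      fun_prop)
    (fun n => by
      refine Filter.Eventually.of_forall fun θ => ?_
      rw [norm_div, norm_pow, Complex.norm_natCast]
      gcongr
      refine (norm_sum_le _ _).trans (Finset.sum_le_sum fun i _ => ?_)
      rw [norm_mul, chi8_norm, mul_one, Complex.norm_real, Real.norm_of_nonneg (hb i)])
    (Filter.Eventually.of_forall fun θ => Real.summable_pow_div_factorial _)
    (by
      haveI : IsFiniteMeasure (volume.restrict (box8 X)) := ⟨by simpa using hfin⟩
      exact integrable_const _)
    (Filter.Eventually.of_forall fun θ => by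
      rw [Complex.exp_eq_exp_ℂ]
      exact NormedSpace.expSeries_div_hasSum_exp _)
  refine key.nonneg fun n => ?_
  rw [integral_div]
  have := pow8 b hb l n 0
  simp only [chi8_zero, mul_one] at this
  exact div_nonneg this (by positivity)

theorem chi8_single {X : Type} [Fintype X] [DecidableEq X] (x y : X) (θ : X → ℝ) :
    chi8 (Pi.single y 1 - Pi.single x 1) θ =
      Complex.exp (Complex.I * (θ y : ℂ)) * conj (Complex.exp (Complex.I * (θ x : ℂ))) := by
  unfold chi8
  rw [← Complex.exp_sum, ← Complex.exp_conj, ← Complex.exp_add]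
  congr 1
  simp only [Pi.sub_apply, Pi.single_apply]
  simp [mul_sub, sub_mul, Finset.sum_sub_distrib]
  ring

/-- Let `L` be a sub-generator on the finite set `X` (nonnegative
off-diagonal entries, nonpositive row sums, nonpositive `m`-weighted column sums) with a mass
gap. Then for every `ρ ∈ [0,∞)^X` the angular integral
`∫_{[0,2π]^X} exp((1/2)⟨L w(θ), w̄(θ)⟩_m) ∏ dθ_u`, with `w(θ)_u = √(ρ_u) e^{i θ_u}`, is a
nonnegative real number (positivity of the density of the twisted squared Gaussian field). -/
theorem stmt8 {X : Type} [Fintype X] [Nonempty X] [DecidableEq X]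
    (m : X → ℝ) (hm : ∀ x, 0 < m x) (L : Matrix X X ℝ)
    (hoff : ∀ x y, x ≠ y → 0 ≤ L x y)
    (hrow : ∀ x, ∑ y, L x y ≤ 0)
    (hcol : ∀ y, ∑ x, m x * L x y ≤ 0)
    (ε : ℝ) (hε : 0 < ε)
    (hL : ∀ z : X → ℂ,
      ε * ∑ x, Complex.normSq (z x) * m x ≤
        (∑ x, (-(L.map Complex.ofReal *ᵥ z) x) * conj (z x) * (m x : ℂ)).re)
    (ρ : X → ℝ) (hρ : ∀ x, 0 ≤ ρ x) :
    (∫ θ in (Set.univ.pi fun _ : X => Set.Icc (0 : ℝ) (2 * Real.pi)),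
        Complex.exp ((1/2) * ∑ x,
          (L.map Complex.ofReal *ᵥ
              (fun u => (Real.sqrt (ρ u) : ℂ) * Complex.exp (Complex.I * (θ u : ℂ)))) x *
            conj ((Real.sqrt (ρ x) : ℂ) * Complex.exp (Complex.I * (θ x : ℂ))) *
            (m x : ℂ))).im = 0 ∧
    0 ≤ (∫ θ in (Set.univ.pi fun _ : X => Set.Icc (0 : ℝ) (2 * Real.pi)),
        Complex.exp ((1/2) * ∑ x,
          (L.map Complex.ofReal *ᵥ
              (fun u => (Real.sqrt (ρ u) : ℂ) * Complex.exp (Complex.I * (θ u : ℂ)))) x *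
            conj ((Real.sqrt (ρ x) : ℂ) * Complex.exp (Complex.I * (θ x : ℂ))) *
            (m x : ℂ))).re := by
  have hE : ∀ θ : X → ℝ, Complex.exp ((1/2) * ∑ x,
          (L.map Complex.ofReal *ᵥ
              (fun u => (Real.sqrt (ρ u) : ℂ) * Complex.exp (Complex.I * (θ u : ℂ)))) x *
            conj ((Real.sqrt (ρ x) : ℂ) * Complex.exp (Complex.I * (θ x : ℂ))) *
            (m x : ℂ)) =
      Complex.exp ((∑ x, 1/2 * L x x * ρ x * m x : ℝ) : ℂ) *
        Complex.exp (∑ p : X × X, ((if p.1 = p.2 then 0 else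
          1/2 * L p.1 p.2 * Real.sqrt (ρ p.1) * Real.sqrt (ρ p.2) * m p.1 : ℝ) : ℂ) *
          chi8 (Pi.single p.2 1 - Pi.single p.1 1) θ) := by
    intro θ
    rw [← Complex.exp_add]
    congr 1
    rw [Fintype.sum_prod_type]
    push_cast
    rw [← Finset.sum_add_distrib, Finset.mul_sum]
    refine Finset.sum_congr rfl fun x _ => ?_
    simp only [Matrix.mulVec, dotProduct, Matrix.map_apply]
    have hs : (1/2 * L x x * ρ x * m x : ℂ) = ∑ y, if x = y then
        (1/2 * L x x * ρ x * m x : ℂ) else 0 := by simp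
    rw [hs, ← Finset.sum_add_distrib, Finset.sum_mul, Finset.sum_mul, Finset.mul_sum]
    refine Finset.sum_congr rfl fun y _ => ?_
    by_cases h : x = y
    · subst h
      have h1 : Complex.exp (Complex.I * (θ x : ℂ)) * conj (Complex.exp (Complex.I * (θ x : ℂ)))
          = 1 := by
        rw [← chi8_single x x θ, sub_self, chi8_zero]
      have h2 : (Real.sqrt (ρ x) : ℂ) * (Real.sqrt (ρ x) : ℂ) = (ρ x : ℂ) := by
        exact_mod_cast Real.mul_self_sqrt (hρ x)
      simp only [if_true, map_mul, Complex.conj_ofReal, Complex.ofReal_zero, zero_mul, add_zero]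
      rw [← h2]
      linear_combination (1/2 * (L x x : ℂ) * (Real.sqrt (ρ x) : ℂ) * (Real.sqrt (ρ x) : ℂ)
        * (m x : ℂ)) * h1
    · simp only [if_neg h, map_mul, Complex.conj_ofReal, chi8_single]
      push_cast
      ring
  have main := exp8 (fun p : X × X => if p.1 = p.2 then 0 else
          1/2 * L p.1 p.2 * Real.sqrt (ρ p.1) * Real.sqrt (ρ p.2) * m p.1)
    (fun p => by
      split_ifs with h
      · exact le_rfl
      · have := hoff _ _ h
        have := (hm p.1).le
        positivity)
    (fun p => Pi.single p.2 1 - Pi.single p.1 1)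
  simp_rw [hE]
  rw [integral_const_mul]
  have h0 : (0 : ℂ) ≤ Complex.exp ((∑ x, 1/2 * L x x * ρ x * m x : ℝ) : ℂ) := by
    rw [← Complex.ofReal_exp]
    exact_mod_cast (Real.exp_pos _).le
  have := Complex.le_def.1 (mul_nonneg h0 main)
  exact ⟨this.2.symm, this.1⟩
end

section
/- Let C be a real symmetric positive semidefinite n×n matrix and B a real skew-symmetric n×n matrix. Let w₁, w₂ be independent standard Gaussian random vectors in ℝ^n and set ψ = w₁ + i w₂ ∈ ℂ^n. Then E[exp(−(1/2)⟨(C − B)ψ, ψ̄⟩)] = det(I + C + B)^{−1}, where for a real n×n matrix M, ⟨Mψ, ψ̄⟩ = Σ_k (Mψ)_k \overline{ψ_k}. -/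
open MeasureTheory Matrix ProbabilityTheory ComplexConjugate

lemma pi_gauss (n : ℕ) : (Measure.pi fun _ : Fin n => gaussianReal 0 1) =
    (volume : Measure (Fin n → ℝ)).withDensity
      (fun x => ENNReal.ofReal (∏ i, gaussianPDFReal 0 1 (x i))) := by
  refine Measure.pi_eq fun s hs => ?_
  have hbox : MeasurableSet (Set.univ.pi s) := MeasurableSet.univ_pi hs
  rw [withDensity_apply _ hbox, ← lintegral_indicator hbox]
  have h1 : ∀ x : Fin n → ℝ, (Set.univ.pi s).indicator
      (fun x => ENNReal.ofReal (∏ i, gaussianPDFReal 0 1 (x i))) x =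
      ENNReal.ofReal (∏ i, (s i).indicator (gaussianPDFReal 0 1) (x i)) := by
    intro x
    by_cases hx : x ∈ Set.univ.pi s
    · rw [Set.indicator_of_mem hx]
      congr 1
      refine Finset.prod_congr rfl fun i _ => ?_
      rw [Set.indicator_of_mem (hx i (Set.mem_univ _))]
    · rw [Set.indicator_of_notMem hx]
      simp only [Set.mem_pi, Set.mem_univ, true_implies, not_forall] at hx
      obtain ⟨i, hi⟩ := hx
      rw [Finset.prod_eq_zero (Finset.mem_univ i) (Set.indicator_of_notMem hi _)]
      simp
  have hint : ∀ i, Integrable ((s i).indicator (gaussianPDFReal 0 1)) :=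
    fun i => (integrable_gaussianPDFReal 0 1).indicator (hs i)
  have hnn : ∀ i x, 0 ≤ (s i).indicator (gaussianPDFReal 0 1) x :=
    fun i x => Set.indicator_nonneg (fun y _ => gaussianPDFReal_nonneg 0 1 y) x
  simp_rw [h1]
  rw [← ofReal_integral_eq_lintegral_ofReal (by
      have := Integrable.fintype_prod hint
      rwa [← volume_pi] at this)
    (ae_of_all _ fun x => Finset.prod_nonneg fun i _ => hnn i _),
    integral_fintype_prod_volume_eq_prod, ENNReal.ofReal_prod_of_nonneg
      (fun i _ => integral_nonneg (hnn i))]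
  refine Finset.prod_congr rfl fun i _ => ?_
  rw [integral_indicator (hs i), gaussianReal_apply_eq_integral 0 one_ne_zero]

lemma exists_sq {n : ℕ} {P : Matrix (Fin n) (Fin n) ℝ} (hP : P.PosDef) :
    ∃ A : Matrix (Fin n) (Fin n) ℝ, Aᵀ * A = P := by
  open scoped MatrixOrder in
  have h := hP.posSemidef.nonneg
  rw [CStarAlgebra.nonneg_iff_eq_star_mul_self] at h
  obtain ⟨A, hA⟩ := h
  exact ⟨A, hA.symm⟩

lemma gauss_int {n : ℕ} (C : Matrix (Fin n) (Fin n) ℝ) (hC : C.PosSemidef) (c : Fin n → ℝ) :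
    ∫ w : Fin n → ℝ, Complex.exp (((-(1/2) * (w ⬝ᵥ C *ᵥ w) : ℝ) : ℂ) +
        Complex.I * ((c ⬝ᵥ w : ℝ) : ℂ)) ∂(Measure.pi fun _ : Fin n => gaussianReal 0 1) =
      (((√(1 + C).det)⁻¹ : ℝ) : ℂ) *
        Complex.exp ((-(1/2) * (c ⬝ᵥ (1 + C)⁻¹ *ᵥ c) : ℝ) : ℂ) := by
  have hP : (1 + C).PosDef := PosDef.one.add_posSemidef hC
  obtain ⟨A, hA⟩ := exists_sq hP
  have hdet : (1 + C).det = A.det ^ 2 := by rw [← hA, det_mul, det_transpose]; ring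
  have hd0 : A.det ≠ 0 := by
    intro h
    have := hP.det_pos
    rw [hdet, h] at this
    norm_num at this
  have hAu : IsUnit A.det := isUnit_iff_ne_zero.2 hd0
  set d : Fin n → ℝ := (A⁻¹)ᵀ *ᵥ c with hd
  have hsum : ∀ w : Fin n → ℝ, ∑ i, (A *ᵥ w) i ^ 2 = w ⬝ᵥ w + w ⬝ᵥ C *ᵥ w := by
    intro w
    have : w ⬝ᵥ (1 + C) *ᵥ w = w ⬝ᵥ w + w ⬝ᵥ C *ᵥ w := by
      rw [add_mulVec, one_mulVec, dotProduct_add]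
    rw [← this, ← hA, ← mulVec_mulVec, dotProduct_mulVec, vecMul_transpose]
    simp [dotProduct, sq]
  have hdw : ∀ w : Fin n → ℝ, d ⬝ᵥ (A *ᵥ w) = c ⬝ᵥ w := by
    intro w
    rw [hd, mulVec_transpose, ← dotProduct_mulVec, mulVec_mulVec, nonsing_inv_mul _ hAu, one_mulVec]
  have hdd : ∑ i, d i ^ 2 = c ⬝ᵥ (1 + C)⁻¹ *ᵥ c := by
    rw [← hA, Matrix.mul_inv_rev, ← mulVec_mulVec, dotProduct_mulVec, ← mulVec_transpose,
      ← transpose_nonsing_inv, ← hd]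
    simp [dotProduct, sq]
  set g : (Fin n → ℝ) → ℂ := fun u => Complex.exp (-(1/2 : ℂ) * ∑ i, (u i : ℂ) ^ 2 +
    ∑ i, (Complex.I * d i) * u i) with hg
  have hgc : Continuous g := by fun_prop
  have hgint : ∫ u, g u = ((√(2 * Real.pi) : ℝ) : ℂ) ^ n *
      Complex.exp ((-(1/2) * (c ⬝ᵥ (1 + C)⁻¹ *ᵥ c) : ℝ) : ℂ) := by
    rw [hg, GaussianFourier.integral_cexp_neg_mul_sum_add (by norm_num)]
    congr 1
    · rw [Real.sqrt_eq_rpow, Complex.ofReal_cpow (by positivity), ← Complex.cpow_nat_mul]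
      simp only [Fintype.card_fin]
      push_cast
      congr 1 <;> ring
    · rw [← hdd]
      congr 1
      push_cast
      simp_rw [mul_pow, Complex.I_sq, ← Finset.mul_sum]
      ring
  rw [pi_gauss, integral_withDensity_eq_integral_toReal_smul]
  · have h1 : ∀ w : Fin n → ℝ,
        (ENNReal.ofReal (∏ i, gaussianPDFReal 0 1 (w i))).toReal •
          Complex.exp (((-(1/2) * (w ⬝ᵥ C *ᵥ w) : ℝ) : ℂ) +
            Complex.I * ((c ⬝ᵥ w : ℝ) : ℂ)) =
        (((√(2 * Real.pi) : ℝ) : ℂ) ^ n)⁻¹ * g (toLin' A w) := by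
      intro w
      rw [ENNReal.toReal_ofReal (Finset.prod_nonneg fun i _ => gaussianPDFReal_nonneg _ _ _)]
      simp only [gaussianPDFReal, Finset.prod_mul_distrib, ← Real.exp_sum, Finset.prod_const]
      rw [Complex.real_smul, hg]
      simp only [toLin'_apply]
      have e1 : (∑ i, (((A *ᵥ w) i : ℝ) : ℂ) ^ 2) = ((w ⬝ᵥ w + w ⬝ᵥ C *ᵥ w : ℝ) : ℂ) := by
        rw [← hsum]; push_cast; rfl
      have e2 : (∑ i, (Complex.I * d i) * (((A *ᵥ w) i : ℝ) : ℂ)) =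
          Complex.I * ((c ⬝ᵥ w : ℝ) : ℂ) := by
        rw [← hdw]; simp only [dotProduct]; push_cast; rw [Finset.mul_sum]
        exact Finset.sum_congr rfl fun i _ => by ring
      rw [e1, e2]
      have e3 : (∑ i, -(w i - 0) ^ 2 / (2 * ((1 : NNReal) : ℝ))) = -(1/2) * (w ⬝ᵥ w) := by
        simp only [dotProduct, Finset.mul_sum]
        exact Finset.sum_congr rfl fun i _ => by simp; ring
      rw [e3]
      push_cast
      rw [mul_assoc, ← Complex.exp_add]
      congr 1
      · simp
        rw [← inv_pow, mul_inv, mul_comm]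
      · congr 1
        ring
    simp_rw [h1]
    rw [integral_const_mul]
    have hm : Measurable (toLin' A) := (LinearMap.continuous_on_pi _).measurable
    rw [← integral_map (φ := toLin' A) (f := g) hm.aemeasurable hgc.aestronglyMeasurable,
      Real.map_matrix_volume_pi_eq_smul_volume_pi hd0, integral_smul_measure, hgint,
      ENNReal.toReal_ofReal (abs_nonneg _), hdet, Real.sqrt_sq_eq_abs, abs_inv, Complex.real_smul]
    have : ((√(2 * Real.pi) : ℝ) : ℂ) ^ n ≠ 0 := by
      apply pow_ne_zero
      exact_mod_cast (by positivity : √(2 * Real.pi) ≠ 0)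
    field_simp
  · exact ((Finset.measurable_prod _ fun i _ =>
      (measurable_gaussianPDFReal 0 1).comp (measurable_pi_apply i))).ennreal_ofReal
  · exact ae_of_all _ fun _ => ENNReal.ofReal_lt_top

lemma det_sq {n : ℕ} (P B : Matrix (Fin n) (Fin n) ℝ) (hP : P.PosDef) (hB : Bᵀ = -B) :
    P.det * (P + B * P⁻¹ * Bᵀ).det = (P + B).det ^ 2 := by
  have hu : IsUnit P.det := isUnit_iff_ne_zero.2 hP.det_pos.ne'
  have hPt : Pᵀ = P := hP.1
  have h1 : (P + B) * P⁻¹ * (P + B)ᵀ = P + B * P⁻¹ * Bᵀ := by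
    rw [transpose_add, hPt, hB, add_mul, mul_nonsing_inv _ hu, add_mul, mul_add, mul_add,
      mul_assoc B, nonsing_inv_mul _ hu]
    simp
  rw [← h1, det_mul, det_mul, det_transpose, det_nonsing_inv, Ring.inverse_eq_inv']
  have := hP.det_pos.ne'
  field_simp

lemma psd {n : ℕ} (P B : Matrix (Fin n) (Fin n) ℝ) (hP : P.PosDef) :
    (B * P⁻¹ * Bᵀ).PosSemidef := by
  simpa using hP.inv.posSemidef.mul_mul_conjTranspose_same B

lemma det_pos' {n : ℕ} (P B : Matrix (Fin n) (Fin n) ℝ) (hP : P.PosDef) (hB : Bᵀ = -B) :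
    0 < (P + B).det := by
  have hne : ∀ t : ℝ, (P + t • B).det ≠ 0 := by
    intro t h
    have h2 := det_sq P (t • B) hP (by simp [hB])
    have h3 := (hP.add_posSemidef (psd P (t • B) hP)).det_pos
    have := mul_pos hP.det_pos h3
    rw [h2, h] at this
    norm_num at this
  have hc : Continuous fun t : ℝ => (P + t • B).det := by fun_prop
  by_contra hcon
  push Not at hcon
  have := intermediate_value_Icc' (zero_le_one' ℝ) hc.continuousOn
  obtain ⟨t, -, ht⟩ := this (show (0 : ℝ) ∈ _ from ⟨by simpa using hcon, by simpa using hP.det_pos.le⟩)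
  exact hne t ht

theorem stmt11 {n : ℕ} (C B : Matrix (Fin n) (Fin n) ℝ)
    (hC : C.PosSemidef) (hB : Bᵀ = -B) :
    (∫ w : (Fin n → ℝ) × (Fin n → ℝ),
        Complex.exp (-(1/2) * ∑ k,
          ((C - B).map Complex.ofReal *ᵥ
              (fun j => (w.1 j : ℂ) + Complex.I * (w.2 j : ℂ))) k *
            conj ((w.1 k : ℂ) + Complex.I * (w.2 k : ℂ)))
        ∂((Measure.pi fun _ : Fin n => gaussianReal 0 1).prod
            (Measure.pi fun _ : Fin n => gaussianReal 0 1))) =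
      ((((1 + C + B).det : ℝ) : ℂ))⁻¹ := by
  have hP : (1 + C).PosDef := PosDef.one.add_posSemidef hC
  have hCt : Cᵀ = C := hC.1
  have key : ∀ w : (Fin n → ℝ) × (Fin n → ℝ), -(1/2) * ∑ k,
          ((C - B).map Complex.ofReal *ᵥ
              (fun j => (w.1 j : ℂ) + Complex.I * (w.2 j : ℂ))) k *
            conj ((w.1 k : ℂ) + Complex.I * (w.2 k : ℂ)) =
      ((-(1/2) * (w.1 ⬝ᵥ C *ᵥ w.1) : ℝ) : ℂ) + (((-(1/2) * (w.2 ⬝ᵥ C *ᵥ w.2) : ℝ) : ℂ) +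
        Complex.I * (((Bᵀ *ᵥ w.1) ⬝ᵥ w.2 : ℝ) : ℂ)) := by
    rintro ⟨x, y⟩
    have s1 : y ⬝ᵥ C *ᵥ x = x ⬝ᵥ C *ᵥ y := by
      rw [dotProduct_mulVec, ← mulVec_transpose, hCt, dotProduct_comm]
    have sk : ∀ x y : Fin n → ℝ, y ⬝ᵥ B *ᵥ x = - (x ⬝ᵥ B *ᵥ y) := by
      intro x y
      rw [dotProduct_mulVec, ← mulVec_transpose, hB, neg_mulVec, neg_dotProduct, dotProduct_comm]
    have s2 : (Bᵀ *ᵥ x) ⬝ᵥ y = x ⬝ᵥ B *ᵥ y := by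
      rw [mulVec_transpose, dotProduct_mulVec]
    have hx : x ⬝ᵥ B *ᵥ x = 0 := by linarith [sk x x]
    have hy : y ⬝ᵥ B *ᵥ y = 0 := by linarith [sk y y]
    have e : ∀ z : Fin n → ℝ, ∀ k, ((C - B).map Complex.ofReal *ᵥ fun j => (z j : ℂ)) k =
        (((C - B) *ᵥ z) k : ℝ) := by
      intro z k
      simp [mulVec, dotProduct]
    have e' : (fun j => (x j : ℂ) + Complex.I * (y j : ℂ)) =
      (fun j => (x j : ℂ)) + Complex.I • (fun j => (y j : ℂ)) := by ext; simp
    have e2 : ∑ k, ((C - B).map Complex.ofReal *ᵥ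
              (fun j => (x j : ℂ) + Complex.I * (y j : ℂ))) k *
            conj ((x k : ℂ) + Complex.I * (y k : ℂ)) =
        ((x ⬝ᵥ (C - B) *ᵥ x + y ⬝ᵥ (C - B) *ᵥ y : ℝ) : ℂ) +
        Complex.I * ((x ⬝ᵥ (C - B) *ᵥ y - y ⬝ᵥ (C - B) *ᵥ x : ℝ) : ℂ) := by
      rw [e', mulVec_add, mulVec_smul]
      simp only [Pi.add_apply, Pi.smul_apply, e, smul_eq_mul, map_add, map_mul, Complex.conj_ofReal,
        Complex.conj_I]
      simp only [dotProduct, ← Finset.sum_add_distrib, ← Finset.sum_sub_distrib]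
      push_cast
      rw [Finset.mul_sum, ← Finset.sum_add_distrib]
      refine Finset.sum_congr rfl fun k _ => ?_
      linear_combination (-(y k : ℂ) * (((C - B) *ᵥ y) k : ℝ)) * Complex.I_sq
    simp only
    rw [e2, s2]
    simp only [sub_mulVec, dotProduct_sub, hx, hy, s1, sk x y]
    push_cast
    ring
  simp_rw [key]
  rw [integral_prod]
  · simp_rw [Complex.exp_add (((-(1/2) * (_ ⬝ᵥ C *ᵥ _) : ℝ) : ℂ)) (_ + _), integral_const_mul, gauss_int C hC]
    have hC' : (C + B * (1 + C)⁻¹ * Bᵀ).PosSemidef := hC.add (psd _ B hP)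
    have h2 := gauss_int _ hC' 0
    have e : ∀ x : Fin n → ℝ, Complex.exp ((-(1/2) * (x ⬝ᵥ C *ᵥ x) : ℝ) : ℂ) *
        ((((√(1 + C).det)⁻¹ : ℝ) : ℂ) *
        Complex.exp ((-(1/2) * ((Bᵀ *ᵥ x) ⬝ᵥ (1 + C)⁻¹ *ᵥ (Bᵀ *ᵥ x)) : ℝ) : ℂ)) =
        (((√(1 + C).det)⁻¹ : ℝ) : ℂ) *
        Complex.exp (((-(1/2) * (x ⬝ᵥ (C + B * (1 + C)⁻¹ * Bᵀ) *ᵥ x) : ℝ) : ℂ) +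
        Complex.I * (((0 : Fin n → ℝ) ⬝ᵥ x : ℝ) : ℂ)) := by
      intro x
      have : (Bᵀ *ᵥ x) ⬝ᵥ (1 + C)⁻¹ *ᵥ (Bᵀ *ᵥ x) = x ⬝ᵥ (B * (1 + C)⁻¹ * Bᵀ) *ᵥ x := by
        rw [← mulVec_mulVec, ← mulVec_mulVec, dotProduct_mulVec x B, ← mulVec_transpose]
      rw [this, add_mulVec, dotProduct_add, mul_left_comm, ← Complex.exp_add]
      simp
      left
      congr 1
      ring
    simp_rw [e]
    rw [integral_const_mul, h2]
    have hd := det_sq (1 + C) B hP hB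
    have hdp := det_pos' (1 + C) B hP hB
    rw [← add_assoc]
    simp only [zero_dotProduct, mul_zero, Complex.ofReal_zero, Complex.exp_zero, mul_one]
    rw [← Complex.ofReal_mul, ← mul_inv, ← Real.sqrt_mul hP.det_pos.le, hd, Real.sqrt_sq hdp.le]
    simp
  · refine Integrable.of_bound (C := 1) (Continuous.aestronglyMeasurable ?_) (ae_of_all _ fun w => ?_)
    · simp only [dotProduct, mulVec]
      fun_prop
    · rw [Complex.norm_exp]
      have a1 : 0 ≤ w.1 ⬝ᵥ C *ᵥ w.1 := by simpa using hC.dotProduct_mulVec_nonneg w.1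
      have a2 : 0 ≤ w.2 ⬝ᵥ C *ᵥ w.2 := by simpa using hC.dotProduct_mulVec_nonneg w.2
      rw [Real.exp_le_one_iff]
      simp only [Complex.add_re, Complex.ofReal_re, Complex.mul_re, Complex.I_re, Complex.I_im,
        Complex.ofReal_im]
      linarith
end

section
/- Let C be a real symmetric positive semidefinite n×n matrix and B a real skew-symmetric n×n matrix. Then det(I + C + B) > 0; in particular I + C + B is invertible. -/
open Matrix

lemma aux_ne {n : ℕ} (C B : Matrix (Fin n) (Fin n) ℝ)
    (hC : C.PosSemidef) (hB : Bᵀ = -B) (t : ℝ) (ht : 0 ≤ t) :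
    (1 + t • (C + B)).det ≠ 0 := by
  intro h
  obtain ⟨v, hv, h0⟩ := Matrix.exists_mulVec_eq_zero_iff.mpr h
  have h1 : v ⬝ᵥ ((1 + t • (C + B)) *ᵥ v) = 0 := by rw [h0]; simp
  have hb : v ⬝ᵥ (B *ᵥ v) = 0 := by
    have h2 : v ⬝ᵥ (B *ᵥ v) = v ⬝ᵥ (Bᵀ *ᵥ v) := by
      rw [Matrix.mulVec_transpose, Matrix.dotProduct_mulVec, dotProduct_comm]
    rw [hB, Matrix.neg_mulVec, dotProduct_neg] at h2
    linarith
  have hc : 0 ≤ v ⬝ᵥ (C *ᵥ v) := by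
    simpa using hC.dotProduct_mulVec_nonneg v
  have hp : 0 < v ⬝ᵥ v := by
    have := Matrix.dotProduct_star_self_pos_iff.mpr hv
    simpa using this
  rw [Matrix.add_mulVec, Matrix.smul_mulVec, Matrix.add_mulVec, Matrix.one_mulVec,
    dotProduct_add, dotProduct_smul, dotProduct_add, hb, smul_eq_mul] at h1
  nlinarith [mul_nonneg ht hc]

/-- For a real symmetric positive semidefinite matrix `C` and a real
skew-symmetric matrix `B`, `det(I + C + B) > 0`; in particular `I + C + B` is invertible. -/
theorem stmt14 {n : ℕ} (C B : Matrix (Fin n) (Fin n) ℝ)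
    (hC : C.PosSemidef) (hB : Bᵀ = -B) :
    0 < (1 + C + B).det ∧ IsUnit (1 + C + B) := by
  have key : 0 < (1 + C + B).det := by
    by_contra hneg
    have hcont : Continuous (fun t : ℝ => (1 + t • (C + B)).det) := by
      apply Continuous.matrix_det
      fun_prop
    have hmem : (0 : ℝ) ∈ Set.Icc ((1 + (1 : ℝ) • (C + B)).det) ((1 + (0 : ℝ) • (C + B)).det) := by
      constructor
      · rw [one_smul, ← add_assoc]; exact not_lt.mp hneg
      · simp
    obtain ⟨t, ht, h⟩ := intermediate_value_Icc' (zero_le_one) hcont.continuousOn hmem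
    exact aux_ne C B hC hB t ht.1 h
  exact ⟨key, (Matrix.isUnit_iff_isUnit_det _).mpr key.ne'.isUnit⟩
end

section
/- Let C be a real symmetric positive semidefinite n×n matrix and B a real skew-symmetric n×n matrix. Then det(I + C) · det(I + C − B(I + C)^{−1}B) = det(I + C + B)², and I + C − B(I+C)^{−1}B is positive definite (so both determinants on the left are positive). -/
open Matrix

/-- For a real symmetric positive semidefinite matrix `C` and a real
skew-symmetric matrix `B`,
`det(I + C) · det(I + C - B (I + C)⁻¹ B) = det(I + C + B)²`, and the matrix
`I + C - B (I + C)⁻¹ B` is positive definite (so both determinants on the left are positive). -/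
theorem stmt15 {n : ℕ} (C B : Matrix (Fin n) (Fin n) ℝ)
    (hC : C.PosSemidef) (hB : Bᵀ = -B) :
    (1 + C).det * (1 + C - B * (1 + C)⁻¹ * B).det = (1 + C + B).det ^ 2 ∧
    (1 + C - B * (1 + C)⁻¹ * B).PosDef := by
  have hA : (1 + C).PosDef := Matrix.PosDef.one.add_posSemidef hC
  have hCt : Cᵀ = C := by
    have h := hC.isHermitian.eq
    rwa [conjTranspose_eq_transpose_of_trivial] at h
  have hAt : (1 + C)ᵀ = 1 + C := by rw [transpose_add, transpose_one, hCt]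
  generalize 1 + C = A at hA hAt
  have hu : IsUnit A.det := hA.det_pos.ne'.isUnit
  have ht : (A + B)ᵀ = A - B := by rw [transpose_add, hAt, hB, sub_eq_add_neg]
  have hfac : A - B * A⁻¹ * B = (A + B) * A⁻¹ * (A - B) := by
    rw [add_mul, mul_nonsing_inv _ hu, add_mul, one_mul, mul_sub,
      mul_assoc B A⁻¹ A, nonsing_inv_mul _ hu, mul_one]
    abel
  refine ⟨?_, ?_⟩
  · have h1 : A.det * (A⁻¹).det = 1 := by
      rw [← det_mul, mul_nonsing_inv _ hu, det_one]
    rw [hfac, ← ht, det_mul, det_mul, det_transpose]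
    linear_combination (A + B).det ^ 2 * h1
  · have h2 : (B * A⁻¹ * Bᴴ).PosSemidef := hA.inv.posSemidef.mul_mul_conjTranspose_same B
    have h3 := hA.add_posSemidef h2
    rw [conjTranspose_eq_transpose_of_trivial, hB, mul_neg, ← sub_eq_add_neg] at h3
    exact h3
end
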